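/- Let G be a simple connected positively curved (in the Lin–Lu–Yau sense) planar graph with minimum degree at least 3, drawn in the plane, let x be a vertex of maximum degree with deg(x) ≥ 18, and let Γ(x) = {v_0, v_1, …, v_{t−1}} be the neighbors of x in clockwise order (indices taken modulo t). Suppose v_k v_{k+ℓ} forms an ℓ-cap for some 4 ≤ ℓ ≤ 8. Then there do not exist i, j ∈ {k+1, …, k+ℓ−1} with j − i ≥ 2 such that v_i v_j forms a (j−i)-cap. -/

import Mathlib

open Filter Set

variable {V : Type*}

-- The `α`-lazy random walk distribution at vertex `x`.
open Classical in
noncomputable def lazyWalk (G : SimpleGraph V) [G.LocallyFinite] (α : ℝ) (x : V) : V → ℝ :=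
  fun v => if v = x then α else if G.Adj x v then (1 - α) / (G.degree x : ℝ) else 0

/-- `A` is a coupling between the finitely supported distributions `m₁` and `m₂`. -/
def IsCoupling (m₁ m₂ : V → ℝ) (A : V → V → ℝ) : Prop :=
  (Function.support fun p : V × V => A p.1 p.2).Finite ∧
  (∀ x y, 0 ≤ A x y ∧ A x y ≤ 1) ∧
  (∀ x, ∑ᶠ y, A x y = m₁ x) ∧
  (∀ y, ∑ᶠ x, A x y = m₂ y)

/-- The transportation (Wasserstein) distance between two distributions on `V`,
with respect to the graph distance of `G`. -/
noncomputable def transportDist (G : SimpleGraph V) (m₁ m₂ : V → ℝ) : ℝ :=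
  sInf {w : ℝ | ∃ A : V → V → ℝ, IsCoupling m₁ m₂ A ∧
    w = ∑ᶠ p : V × V, A p.1 p.2 * (G.dist p.1 p.2 : ℝ)}

/-- The `α`-Ricci curvature `κ_α(x,y)`. -/
noncomputable def alphaRicci (G : SimpleGraph V) [G.LocallyFinite] (α : ℝ) (x y : V) : ℝ :=
  1 - transportDist G (lazyWalk G α x) (lazyWalk G α y) / (G.dist x y : ℝ)

/-- `κ` is the Lin–Lu–Yau Ricci curvature of the pair `(x,y)`:
the limit of `κ_α(x,y)/(1-α)` as `α → 1⁻`. -/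
def HasLLYCurv (G : SimpleGraph V) [G.LocallyFinite] (x y : V) (κ : ℝ) : Prop :=
  Tendsto (fun α : ℝ => alphaRicci G α x y / (1 - α)) (nhdsWithin 1 (Set.Iio 1)) (nhds κ)

/-- `G` is positively curved: every edge has positive Lin–Lu–Yau Ricci curvature. -/
def PositivelyCurved (G : SimpleGraph V) [G.LocallyFinite] : Prop :=
  ∀ ⦃x y : V⦄, G.Adj x y → ∃ κ : ℝ, 0 < κ ∧ HasLLYCurv G x y κ

/-- `G` is planar: it admits a topological embedding in the plane, i.e. an injective
placement of the vertices together with arcs for the edges, where arcs are injective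
continuous curves joining the endpoints, not passing through any other vertex, and
two arcs of distinct edges meet only in common endpoints. -/
def IsPlanar (G : SimpleGraph V) : Prop :=
  ∃ (f : V → ℝ × ℝ) (e : ∀ u v : V, G.Adj u v → Set.Icc (0:ℝ) 1 → ℝ × ℝ),
    Function.Injective f ∧
    (∀ u v (h : G.Adj u v), Continuous (e u v h)) ∧
    (∀ u v (h : G.Adj u v), Function.Injective (e u v h)) ∧
    (∀ u v (h : G.Adj u v),
      e u v h ⟨0, Set.left_mem_Icc.mpr zero_le_one⟩ = f u ∧
      e u v h ⟨1, Set.right_mem_Icc.mpr zero_le_one⟩ = f v) ∧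
    (∀ u v (h : G.Adj u v) (w : V), w ≠ u → w ≠ v → f w ∉ Set.range (e u v h)) ∧
    (∀ u v (h : G.Adj u v) (u' v' : V) (h' : G.Adj u' v'), ({u, v} : Set V) ≠ {u', v'} →
      Set.range (e u v h) ∩ Set.range (e u' v' h') ⊆ (f '' {u, v}) ∩ (f '' {u', v'}))

/-- Given a vertex `x` whose neighbors are enumerated in clockwise order by `v`
(indices modulo the degree of `x`, encoded by the periodicity of `v`),
`v k` and `v (k+ℓ)` form an `ℓ`-cap: either `v k v (k+ℓ)` is an edge (`ℓ`-arc), or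
there is a vertex `z ≠ x` adjacent to both `v k` and `v (k+ℓ)` but to no `v (k+i)`
with `1 ≤ i ≤ ℓ-1`. -/
def IsCap (G : SimpleGraph V) (x : V) (v : ℕ → V) (k ℓ : ℕ) : Prop :=
  G.Adj (v k) (v (k + ℓ)) ∨
  ∃ z : V, z ≠ x ∧ G.Adj (v k) z ∧ G.Adj (v (k + ℓ)) z ∧
    ∀ i : ℕ, 1 ≤ i → i ≤ ℓ - 1 → ¬ G.Adj (v (k + i)) z


section Crossing

theorem cr_arg_pos (θ : ℝ) (h0 : 0 < θ) (h1 : θ < 2 * Real.pi) :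
    (Complex.log (1 - Complex.exp (θ * Complex.I))).im = (θ - Real.pi) / 2 := by
  have hs : 0 < 2 * Real.sin (θ / 2) := by
    have := Real.sin_pos_of_pos_of_lt_pi (x := θ / 2) (by linarith) (by linarith)
    linarith
  have key : (1 - Complex.exp (θ * Complex.I)) =
      ((2 * Real.sin (θ / 2) : ℝ) : ℂ) * (Real.cos ((θ - Real.pi) / 2) +
        Real.sin ((θ - Real.pi) / 2) * Complex.I) := by
    have e1 : (θ - Real.pi) / 2 = θ / 2 - Real.pi / 2 := by ring
    have e2 : (θ : ℂ) = ((2 * (θ / 2) : ℝ) : ℂ) := by push_cast; ring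
    rw [e1, Real.cos_sub_pi_div_two, Real.sin_sub_pi_div_two, e2, Complex.exp_mul_I,
      ← Complex.ofReal_cos, ← Complex.ofReal_sin, Real.cos_two_mul, Real.sin_two_mul]
    have := Real.sin_sq_add_cos_sq (θ / 2)
    generalize Real.sin (θ / 2) = S at *
    generalize Real.cos (θ / 2) = C at *
    have h' : (S : ℂ) ^ 2 + (C : ℂ) ^ 2 = 1 := by exact_mod_cast this
    push_cast
    linear_combination 2 * (-h')
  rw [Complex.log_im, key]
  have := Complex.arg_mul_cos_add_sin_mul_I hs (θ := (θ - Real.pi) / 2)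
    ⟨by linarith [Real.pi_pos], by linarith [Real.pi_pos]⟩
  simpa using this

theorem cr_arg_neg (θ : ℝ) (h0 : -(2 * Real.pi) < θ) (h1 : θ < 0) :
    (Complex.log (1 - Complex.exp (θ * Complex.I))).im = (θ + Real.pi) / 2 := by
  have h := cr_arg_pos (θ + 2 * Real.pi) (by linarith) (by linarith)
  have e : Complex.exp (((θ + 2 * Real.pi : ℝ) : ℂ) * Complex.I) = Complex.exp (θ * Complex.I) := by
    push_cast
    rw [add_mul, Complex.exp_periodic]
  rw [e] at h
  rw [h]; ring

/-- A continuous function whose exponential is constant takes equal values at 0 and 1. -/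
theorem cr_const (g : ℝ → ℂ) (hg : Continuous g) (c : ℂ) (h : ∀ s, Complex.exp (g s) = c) :
    g 1 = g 0 := by
  have h2 : ∀ s, ∃ n : ℤ, g s - g 0 = n * (2 * Real.pi * Complex.I) := by
    intro s
    have : Complex.exp (g s) = Complex.exp (g 0) := by rw [h, h]
    obtain ⟨n, hn⟩ := Complex.exp_eq_exp_iff_exists_int.1 this
    exact ⟨n, by rw [hn]; ring⟩
  choose n hn using h2
  have hpi : (2 * Real.pi : ℝ) ≠ 0 := by positivity
  have hn' : ∀ s, ((n s : ℤ) : ℝ) = (g s - g 0).im / (2 * Real.pi) := by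
    intro s
    rw [hn s, eq_div_iff hpi]
    simp
  have hc : Continuous (fun s => ((n s : ℤ) : ℝ)) := by
    simp_rw [hn']
    fun_prop
  have hc' : Continuous n := Int.isClosedEmbedding_coe_real.isEmbedding.continuous_iff.2 hc
  have : n 1 = n 0 := PreconnectedSpace.constant inferInstance hc'
  have h1 := hn 1
  have h0 := hn 0
  rw [this, ← h0] at h1
  exact sub_eq_zero.1 (h1.trans (sub_self _))

theorem cr_side (g L : ℝ → ℂ) (hg : Continuous g) (hL : Continuous L) (c : ℂ) (β φ0 φ1 : ℝ)
    (hb : ∀ s, ‖g s‖ ≤ 1) (hne : ∀ s, g s ≠ Complex.exp (β * Complex.I))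
    (hexp : ∀ s, Complex.exp (L s) = c * (1 - g s * Complex.exp ((-β : ℝ) * Complex.I)))
    (h0 : g 0 = Complex.exp (φ0 * Complex.I)) (h1 : g 1 = Complex.exp (φ1 * Complex.I)) :
    L 1 - L 0 = Complex.log (1 - Complex.exp ((φ1 - β : ℝ) * Complex.I)) -
      Complex.log (1 - Complex.exp ((φ0 - β : ℝ) * Complex.I)) := by
  set q : ℂ := Complex.exp ((-β : ℝ) * Complex.I) with hq
  have hq1 : ‖q‖ = 1 := Complex.norm_exp_ofReal_mul_I _
  have hqp : Complex.exp (β * Complex.I) * q = 1 := by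
    rw [hq, ← Complex.exp_add]; simp
  have hre : ∀ s, 0 < (1 - g s * q).re := by
    intro s
    have hn : ‖g s * q‖ ≤ 1 := by rw [norm_mul, hq1, mul_one]; exact hb s
    have h2 : (g s * q).re ≤ 1 := (Complex.re_le_norm _).trans hn
    rcases h2.lt_or_eq with h3 | h3
    · simp only [Complex.sub_re, Complex.one_re]; linarith
    · exfalso
      have h4 : g s * q = 1 := by
        have h5 : (g s * q).re ^ 2 + (g s * q).im ^ 2 ≤ 1 := by
          have := Complex.sq_norm (g s * q)
          rw [Complex.normSq_apply] at this
          nlinarith [norm_nonneg (g s * q)]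
        have h6 : (g s * q).im = 0 := by
          rw [h3] at h5; nlinarith [sq_nonneg (g s * q).im]
        exact Complex.ext (by simpa using h3) (by simpa using h6)
      apply hne s
      have hq0 : q ≠ 0 := Complex.exp_ne_zero _
      exact mul_right_cancel₀ hq0 (h4.trans hqp.symm)
  have hne' : ∀ s, (1 - g s * q) ≠ 0 := fun s h => by
    have := hre s; rw [h] at this; simp at this
  have hcont : Continuous (fun s => Complex.log (1 - g s * q)) :=
    Continuous.clog (by fun_prop) (fun s => Or.inl (hre s))
  have := cr_const (fun s => L s - Complex.log (1 - g s * q)) (hL.sub hcont) c (by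
    intro s
    rw [Complex.exp_sub, hexp, Complex.exp_log (hne' s), mul_div_assoc, div_self (hne' s), mul_one])
  have e : ∀ φ : ℝ, Complex.exp (φ * Complex.I) * q = Complex.exp ((φ - β : ℝ) * Complex.I) := by
    intro φ
    rw [hq, ← Complex.exp_add]; congr 1; push_cast; ring
  rw [h0, h1, e, e] at this
  linear_combination this

theorem cr_disc (a b : ℝ → ℂ) (ha : Continuous a) (hb : Continuous b)
    (ha1 : ∀ s, ‖a s‖ ≤ 1) (hb1 : ∀ s, ‖b s‖ ≤ 1) (hab : ∀ s t, a s ≠ b t)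
    (α β γ δ : ℝ) (h1 : α < β) (h2 : β < γ) (h3 : γ < δ) (h4 : δ < α + 2 * Real.pi)
    (ha0 : a 0 = Complex.exp (α * Complex.I)) (ha1' : a 1 = Complex.exp (γ * Complex.I))
    (hb0 : b 0 = Complex.exp (β * Complex.I)) (hb1' : b 1 = Complex.exp (δ * Complex.I)) :
    False := by
  have hF0 : ∀ p : ℝ × ℝ, a p.1 - b p.2 ≠ 0 := fun p => sub_ne_zero.2 (hab _ _)
  obtain ⟨L, ⟨-, hL⟩, -⟩ := Complex.isCoveringMapOn_exp.existsUnique_continuousMap_lifts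
    (A := ℝ × ℝ) ⟨fun p => a p.1 - b p.2, by fun_prop⟩ (a₀ := (0, 0))
    (e₀ := Complex.log (a 0 - b 0)) (Complex.exp_log (hF0 (0, 0))) (fun p => hF0 p)
  have hL' : ∀ s t, Complex.exp (L (s, t)) = a s - b t := fun s t => congr_fun hL (s, t)
  have hinv : ∀ φ : ℝ, Complex.exp (φ * Complex.I) * Complex.exp ((-φ : ℝ) * Complex.I) = 1 := by
    intro φ; rw [← Complex.exp_add]; simp
  have s1 := cr_side a (fun s => L (s, 0)) ha (by fun_prop) (-Complex.exp (β * Complex.I)) β α γ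
    ha1 (fun s => hb0 ▸ hab s 0) (fun s => by
      rw [hL', hb0]; linear_combination (a s) * (-hinv β)) ha0 ha1'
  have s2 := cr_side a (fun s => L (s, 1)) ha (by fun_prop) (-Complex.exp (δ * Complex.I)) δ α γ
    ha1 (fun s => hb1' ▸ hab s 1) (fun s => by
      rw [hL', hb1']; linear_combination (a s) * (-hinv δ)) ha0 ha1'
  have s3 := cr_side b (fun s => L (0, s)) hb (by fun_prop) (Complex.exp (α * Complex.I)) α β δ
    hb1 (fun s => ha0 ▸ (hab 0 s).symm) (fun s => by
      rw [hL', ha0]; linear_combination (b s) * (hinv α)) hb0 hb1'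
  have s4 := cr_side b (fun s => L (1, s)) hb (by fun_prop) (Complex.exp (γ * Complex.I)) γ β δ
    hb1 (fun s => ha1' ▸ (hab 1 s).symm) (fun s => by
      rw [hL', ha1']; linear_combination (b s) * (hinv γ)) hb0 hb1'
  have t1 := congrArg Complex.im s1
  have t2 := congrArg Complex.im s2
  have t3 := congrArg Complex.im s3
  have t4 := congrArg Complex.im s4
  simp only [Complex.sub_im] at t1 t2 t3 t4
  rw [cr_arg_pos (γ - β) (by linarith) (by linarith),
    cr_arg_neg (α - β) (by linarith) (by linarith)] at t1
  rw [cr_arg_neg (γ - δ) (by linarith) (by linarith),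
    cr_arg_neg (α - δ) (by linarith) (by linarith)] at t2
  rw [cr_arg_pos (δ - α) (by linarith) (by linarith),
    cr_arg_pos (β - α) (by linarith) (by linarith)] at t3
  rw [cr_arg_pos (δ - γ) (by linarith) (by linarith),
    cr_arg_neg (β - γ) (by linarith) (by linarith)] at t4
  linarith [Real.pi_pos]

/-- Crossing lemma outside a disc, with path connected sets. -/
theorem cr_outside (S T : Set ℂ) (hS : IsPathConnected S) (hT : IsPathConnected T)
    (hST : Disjoint S T) (x0 : ℂ) (r : ℝ) (hr : 0 < r)
    (hS1 : ∀ z ∈ S, r ≤ ‖z - x0‖) (hT1 : ∀ z ∈ T, r ≤ ‖z - x0‖)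
    (α β γ δ : ℝ) (h1 : α < β) (h2 : β < γ) (h3 : γ < δ) (h4 : δ < α + 2 * Real.pi)
    (ha : x0 + r * Complex.exp (α * Complex.I) ∈ S) (hc : x0 + r * Complex.exp (γ * Complex.I) ∈ S)
    (hb : x0 + r * Complex.exp (β * Complex.I) ∈ T)
    (hd : x0 + r * Complex.exp (δ * Complex.I) ∈ T) : False := by
  obtain ⟨p, hp⟩ := hS.joinedIn _ hc _ ha
  obtain ⟨q, hq⟩ := hT.joinedIn _ hd _ hb
  have hp' : ∀ s, p.extend s ∈ S := fun s => by
    have : p.extend s ∈ range p.extend := ⟨s, rfl⟩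
    rw [Path.extend_range] at this
    obtain ⟨t, ht⟩ := this
    rw [← ht]; exact hp t
  have hq' : ∀ s, q.extend s ∈ T := fun s => by
    have : q.extend s ∈ range q.extend := ⟨s, rfl⟩
    rw [Path.extend_range] at this
    obtain ⟨t, ht⟩ := this
    rw [← ht]; exact hq t
  have hrc : (r : ℂ) ≠ 0 := by exact_mod_cast hr.ne'
  have hp0 : ∀ s, p.extend s - x0 ≠ 0 := fun s h => by
    have := hS1 _ (hp' s); rw [h, norm_zero] at this; linarith
  have hq0 : ∀ s, q.extend s - x0 ≠ 0 := fun s h => by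
    have := hT1 _ (hq' s); rw [h, norm_zero] at this; linarith
  have hval : ∀ φ : ℝ, (r : ℂ) / (x0 + r * Complex.exp (φ * Complex.I) - x0) =
      Complex.exp ((-φ : ℝ) * Complex.I) := by
    intro φ
    have : Complex.exp (φ * Complex.I) ≠ 0 := Complex.exp_ne_zero _
    rw [add_sub_cancel_left, div_mul_eq_div_div, div_self hrc, one_div, ← Complex.exp_neg]
    congr 1; push_cast; ring
  refine cr_disc (fun s => r / (q.extend s - x0)) (fun s => r / (p.extend s - x0))
    (Continuous.div (by fun_prop) (by fun_prop) hq0)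
    (Continuous.div (by fun_prop) (by fun_prop) hp0) ?_ ?_ ?_ (-δ) (-γ) (-β) (-α)
    (by linarith) (by linarith) (by linarith) (by linarith) ?_ ?_ ?_ ?_
  · intro s
    rw [norm_div, Complex.norm_real, Real.norm_of_nonneg hr.le,
      div_le_one (norm_pos_iff.2 (hq0 s))]
    exact hT1 _ (hq' s)
  · intro s
    rw [norm_div, Complex.norm_real, Real.norm_of_nonneg hr.le,
      div_le_one (norm_pos_iff.2 (hp0 s))]
    exact hS1 _ (hp' s)
  · intro s t h
    rw [div_eq_div_iff (hq0 _) (hp0 _)] at h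
    have h5 := mul_left_cancel₀ hrc h
    have h6 : p.extend t = q.extend s := sub_left_injective h5
    exact Set.disjoint_left.1 hST (hp' t) (h6 ▸ hq' s)
  · simp only [Path.extend_zero]; rw [hval]
  · simp only [Path.extend_one]; rw [hval]
  · simp only [Path.extend_zero]; rw [hval]
  · simp only [Path.extend_one]; rw [hval]

end Crossing

section CoreComb

/-- Connectors between neighbours of `x`: either a vertex outside the closed neighbourhood of `x`
or an edge. `CInc G x e a` says that the connector `e` is incident with `a`. -/
def CInc (G : SimpleGraph V) (x : V) : V ⊕ Sym2 V → V → Prop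
  | Sum.inl w, a => G.Adj w a ∧ ¬ G.Adj x w ∧ w ≠ x
  | Sum.inr s, a => a ∈ s ∧ s ∈ G.edgeSet

/-- `a` is in the region seen from `y` when the neighbour `e` of `y` is ignored. -/
def CCov (G : SimpleGraph V) (x y e a : V) : Prop :=
  a = y ∨ G.Adj y a ∨ ∃ z, z ≠ x ∧ z ≠ e ∧ G.Adj y z ∧ G.Adj z a

/-- The combinatorial data extracted from the drawing and the curvature. -/
structure Core (G : SimpleGraph V) [G.LocallyFinite] (x : V) (D : ℤ) (u : ℤ → V) : Prop where
  hD : 18 ≤ D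
  per : ∀ i, u (i + D) = u i
  inj : ∀ i j, i ≤ j → j < i + D → u i = u j → i = j
  adj : ∀ i, G.Adj x (u i)
  surj : ∀ a, G.Adj x a → ∀ k, ∃ j, k ≤ j ∧ j < k + D ∧ u j = a
  nc : ∀ e e' i j k l, i < j → j < k → k < l → l < i + D → e ≠ e' →
    CInc G x e (u i) → CInc G x e (u k) → CInc G x e' (u j) → CInc G x e' (u l) → False
  deg : ∀ y, 3 ≤ G.degree (u y)
  star : ∀ (y : ℤ) (e : V) (S T : Finset ℤ),
    (∀ a, G.Adj x a → CCov G x (u y) e a → ∃ j ∈ S, u j = a) →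
    (∀ a, G.Adj x a → G.Adj (u y) a → a ≠ e → ∃ j ∈ T, u j = a) →
    18 * ((G.degree (u y) : ℤ) - 2) < G.degree (u y) * (S.card + 1 + T.card : ℤ)
  star0 : ∀ (y : ℤ) (S T : Finset ℤ),
    (∀ a, G.Adj x a → CCov G x (u y) x a → ∃ j ∈ S, u j = a) →
    (∀ a, G.Adj x a → G.Adj (u y) a → ∃ j ∈ T, u j = a) →
    18 * ((G.degree (u y) : ℤ) - 1) < G.degree (u y) * (S.card + 1 + T.card : ℤ)

namespace Core

variable {G : SimpleGraph V} [G.LocallyFinite] {x : V} {D : ℤ} {u : ℤ → V}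

/-- A cap: an interval of indices joined by a connector not touching the interior. -/
def Cap (G : SimpleGraph V) (x : V) (D : ℤ) (u : ℤ → V) (k m : ℤ) : Prop :=
  k < m ∧ m < k + D ∧ ∃ e, CInc G x e (u k) ∧ CInc G x e (u m) ∧
    ∀ i, k < i → i < m → ¬ CInc G x e (u i)

theorem reflect (C : Core G x D u) : Core G x D (fun i => u (-i)) where
  hD := C.hD
  per i := by
    have := C.per (-(i + D)); rw [← this]; congr 1; ring
  inj i j h1 h2 h := by
    have := C.inj (-j) (-i) (by omega) (by omega) h.symm; omega
  adj i := C.adj _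
  surj a ha k := by
    obtain ⟨j, h1, h2, h3⟩ := C.surj a ha (-k - D + 1)
    exact ⟨-j, by omega, by omega, by simpa using h3⟩
  nc e e' i j k l h1 h2 h3 h4 hne a1 a2 a3 a4 :=
    C.nc e' e (-l) (-k) (-j) (-i) (by omega) (by omega) (by omega) (by omega) hne.symm a4 a3 a2 a1
  deg y := C.deg _
  star y e S T h1 h2 := by
    have := C.star (-y) e (S.image (fun i => -i)) (T.image (fun i => -i))
      (fun a ha hc => by
        obtain ⟨j, hj, rfl⟩ := h1 a ha hc
        exact ⟨-j, Finset.mem_image_of_mem _ hj, rfl⟩)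
      (fun a ha hc he => by
        obtain ⟨j, hj, rfl⟩ := h2 a ha hc he
        exact ⟨-j, Finset.mem_image_of_mem _ hj, rfl⟩)
    rwa [Finset.card_image_of_injective _ neg_injective,
      Finset.card_image_of_injective _ neg_injective] at this
  star0 y S T h1 h2 := by
    have := C.star0 (-y) (S.image (fun i => -i)) (T.image (fun i => -i))
      (fun a ha hc => by
        obtain ⟨j, hj, rfl⟩ := h1 a ha hc
        exact ⟨-j, Finset.mem_image_of_mem _ hj, rfl⟩)
      (fun a ha hc => by
        obtain ⟨j, hj, rfl⟩ := h2 a ha hc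
        exact ⟨-j, Finset.mem_image_of_mem _ hj, rfl⟩)
    rwa [Finset.card_image_of_injective _ neg_injective,
      Finset.card_image_of_injective _ neg_injective] at this

theorem cap_reflect {k m : ℤ} (h : Cap G x D u k m) :
    Cap G x D (fun i => u (-i)) (-m) (-k) := by
  obtain ⟨h1, h2, e, he1, he2, he3⟩ := h
  exact ⟨by omega, by omega, e, by simpa using he2, by simpa using he1,
    fun i hi1 hi2 => he3 (-i) (by omega) (by omega)⟩

theorem cap_of_reflect {k m : ℤ} (h : Cap G x D (fun i => u (-i)) k m) :
    Cap G x D u (-m) (-k) := by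
  obtain ⟨h1, h2, e, he1, he2, he3⟩ := h
  exact ⟨by omega, by omega, e, he2, he1,
    fun i hi1 hi2 => by simpa using he3 (-i) (by omega) (by omega)⟩

theorem starA (C : Core G x D u) (y : ℤ) (e : V) (S T : Finset ℤ) (hc : S.card + T.card ≤ 5)
    (h1 : ∀ a, G.Adj x a → CCov G x (u y) e a → ∃ j ∈ S, u j = a)
    (h2 : ∀ a, G.Adj x a → G.Adj (u y) a → a ≠ e → ∃ j ∈ T, u j = a) : False := by
  have h := C.star y e S T h1 h2
  have hd := C.deg y
  have : (S.card + 1 + T.card : ℤ) ≤ 6 := by omega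
  nlinarith

theorem starA4 (C : Core G x D u) (y : ℤ) (e : V) (S T : Finset ℤ) (hc : S.card + T.card ≤ 8)
    (hd : 4 ≤ G.degree (u y))
    (h1 : ∀ a, G.Adj x a → CCov G x (u y) e a → ∃ j ∈ S, u j = a)
    (h2 : ∀ a, G.Adj x a → G.Adj (u y) a → a ≠ e → ∃ j ∈ T, u j = a) : False := by
  have h := C.star y e S T h1 h2
  have : (S.card + 1 + T.card : ℤ) ≤ 9 := by omega
  nlinarith

theorem starB (C : Core G x D u) (y : ℤ) (S T : Finset ℤ) (hc : S.card + T.card ≤ 11)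
    (h1 : ∀ a, G.Adj x a → CCov G x (u y) x a → ∃ j ∈ S, u j = a)
    (h2 : ∀ a, G.Adj x a → G.Adj (u y) a → ∃ j ∈ T, u j = a) : False := by
  have h := C.star0 y S T h1 h2
  have hd := C.deg y
  have : (S.card + 1 + T.card : ℤ) ≤ 12 := by omega
  nlinarith

theorem inc_edge {a b : V} (h : G.Adj a b) :
    CInc G x (Sum.inr s(a, b)) a ∧ CInc G x (Sum.inr s(a, b)) b :=
  ⟨⟨by simp, h⟩, ⟨by simp, h⟩⟩

theorem edge_cap (C : Core G x D u) {i j : ℤ} (hij : i < j) (hj : j < i + D)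
    (h : G.Adj (u i) (u j)) : Cap G x D u i j := by
  refine ⟨hij, hj, Sum.inr s(u i, u j), (inc_edge h).1, (inc_edge h).2, ?_⟩
  rintro l h1 h2 ⟨hl, -⟩
  rcases Sym2.mem_iff.1 hl with h3 | h3
  · have := C.inj i l (by omega) (by omega) h3.symm; omega
  · have := C.inj l j (by omega) (by omega) h3; omega

/-- Two crossing edges are impossible. -/
theorem nc_edge (C : Core G x D u) {i j k l : ℤ} (h1 : i < j) (h2 : j < k) (h3 : k < l)
    (h4 : l < i + D) (a : G.Adj (u i) (u k)) (b : G.Adj (u j) (u l)) : False := by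
  refine C.nc (Sum.inr s(u i, u k)) (Sum.inr s(u j, u l)) i j k l h1 h2 h3 h4 ?_
    (inc_edge a).1 (inc_edge a).2 (inc_edge b).1 (inc_edge b).2
  intro h
  have h5 : u j ∈ s(u i, u k) := by rw [Sum.inr.inj h]; simp
  rcases Sym2.mem_iff.1 h5 with h6 | h6
  · have := C.inj i j (by omega) (by omega) h6.symm; omega
  · have := C.inj j k (by omega) (by omega) h6; omega

theorem conf_idx (C : Core G x D u) {k m y j : ℤ} (hc : Cap G x D u k m) (h1 : k < y) (h2 : y < m)
    {e : V ⊕ Sym2 V} (he : CInc G x e (u y)) (hk : k ≤ j) (hj : j < k + D)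
    (hej : CInc G x e (u j)) : j ≤ m := by
  by_contra hlt
  obtain ⟨h3, h4, e0, h5, h6, h7⟩ := hc
  refine C.nc e0 e k y m j h1 h2 (by omega) hj ?_ h5 h6 he hej
  rintro rfl
  exact h7 y h1 h2 he

theorem conf_inc (C : Core G x D u) {k m y : ℤ} (hc : Cap G x D u k m) (h1 : k < y) (h2 : y < m)
    {e : V ⊕ Sym2 V} (he : CInc G x e (u y)) {a : V} (ha : G.Adj x a) (hea : CInc G x e a) :
    ∃ j, k ≤ j ∧ j ≤ m ∧ u j = a := by
  obtain ⟨j, hj1, hj2, rfl⟩ := C.surj a ha k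
  exact ⟨j, hj1, C.conf_idx hc h1 h2 he hj1 hj2 hea, rfl⟩

theorem conf_adj (C : Core G x D u) {k m y : ℤ} (hc : Cap G x D u k m) (h1 : k < y) (h2 : y < m)
    {a : V} (ha : G.Adj x a) (hya : G.Adj (u y) a) :
    ∃ j, k ≤ j ∧ j ≤ m ∧ j ≠ y ∧ u j = a := by
  obtain ⟨j, hj1, hj2, rfl⟩ := C.conf_inc hc h1 h2 (inc_edge hya).1 ha (inc_edge hya).2
  exact ⟨j, hj1, hj2, by rintro rfl; exact hya.ne rfl, rfl⟩

/-- Analysis of the region seen from an interior vertex of a cap. -/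
theorem cov_cases (C : Core G x D u) {k m y : ℤ} (hc : Cap G x D u k m) (h1 : k < y) (h2 : y < m)
    {e a : V} (ha : G.Adj x a) (hcov : CCov G x (u y) e a) :
    (∃ j, k ≤ j ∧ j ≤ m ∧ u j = a ∧ (j = y ∨ G.Adj (u y) (u j) ∨
      ∃ w, w ≠ e ∧ CInc G x (Sum.inl w) (u y) ∧ CInc G x (Sum.inl w) (u j))) ∨
    ∃ i, k ≤ i ∧ i ≤ m ∧ i ≠ y ∧ u i ≠ e ∧ G.Adj (u y) (u i) ∧ G.Adj (u i) a := by
  rcases hcov with rfl | h | ⟨z, hzx, hze, hyz, hza⟩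
  · exact Or.inl ⟨y, h1.le, h2.le, rfl, Or.inl rfl⟩
  · obtain ⟨j, hj1, hj2, -, rfl⟩ := C.conf_adj hc h1 h2 ha h
    exact Or.inl ⟨j, hj1, hj2, rfl, Or.inr (Or.inl h)⟩
  · by_cases hxz : G.Adj x z
    · obtain ⟨j, hj1, hj2, hj3, rfl⟩ := C.conf_adj hc h1 h2 hxz hyz
      exact Or.inr ⟨j, hj1, hj2, hj3, hze, hyz, hza⟩
    · have i1 : CInc G x (Sum.inl z) (u y) := ⟨hyz.symm, hxz, hzx⟩
      have i2 : CInc G x (Sum.inl z) a := ⟨hza, hxz, hzx⟩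
      obtain ⟨j, hj1, hj2, rfl⟩ := C.conf_inc hc h1 h2 i1 ha i2
      exact Or.inl ⟨j, hj1, hj2, rfl, Or.inr (Or.inr ⟨z, hze, i1, i2⟩)⟩

/-- A gap of a connector contains a cap around a missed index. -/
theorem gap (C : Core G x D u) {a b j : ℤ} {e : V ⊕ Sym2 V} (h1 : a < j) (h2 : j < b)
    (hb : b < a + D) (ha : CInc G x e (u a)) (hbe : CInc G x e (u b)) (hj : ¬ CInc G x e (u j)) :
    ∃ a' b', a ≤ a' ∧ a' < j ∧ j < b' ∧ b' ≤ b ∧ Cap G x D u a' b' ∧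
      CInc G x e (u a') ∧ CInc G x e (u b') := by
  classical
  obtain ⟨a', ⟨ha1, ha2⟩, ha3⟩ := Int.exists_greatest_of_bdd
    (P := fun i => i < j ∧ CInc G x e (u i)) ⟨j, fun z hz => hz.1.le⟩ ⟨a, h1, ha⟩
  obtain ⟨b', ⟨hb1, hb2⟩, hb3⟩ := Int.exists_least_of_bdd
    (P := fun i => j < i ∧ CInc G x e (u i)) ⟨j, fun z hz => hz.1.le⟩ ⟨b, h2, hbe⟩
  have e1 := ha3 a ⟨h1, ha⟩
  have e2 := hb3 b ⟨h2, hbe⟩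
  refine ⟨a', b', e1, ha1, hb1, e2, ⟨by omega, by omega, e, ha2, hb2, ?_⟩, ha2, hb2⟩
  intro i hi1 hi2 hi
  rcases lt_trichotomy i j with h | rfl | h
  · have := ha3 i ⟨h, hi⟩; omega
  · exact hj hi
  · have := hb3 i ⟨h, hi⟩; omega

/-- Short caps: an interior vertex with at most two neighbours in `A`, all interior. -/
theorem short (C : Core G x D u) {k m y : ℤ} (hc : Cap G x D u k m) (hm : m ≤ k + 8)
    (h1 : k < y) (h2 : y < m) (T : Finset ℤ) (hT : T.card ≤ 2)
    (h : ∀ j, k ≤ j → j ≤ m → j ≠ y → G.Adj (u y) (u j) → j ∈ T ∧ k < j ∧ j < m) : False := by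
  refine C.starB y (Finset.Icc k m) T ?_ ?_ ?_
  · simp; omega
  · intro a ha hcov
    rcases C.cov_cases hc h1 h2 ha hcov with ⟨j, hj1, hj2, rfl, -⟩ | ⟨i, hi1, hi2, hi3, -, hi4, hi5⟩
    · exact ⟨j, Finset.mem_Icc.2 ⟨hj1, hj2⟩, rfl⟩
    · obtain ⟨-, g1, g2⟩ := h i hi1 hi2 hi3 hi4
      obtain ⟨j, hj1, hj2, -, rfl⟩ := C.conf_adj hc g1 g2 ha hi5
      exact ⟨j, Finset.mem_Icc.2 ⟨hj1, hj2⟩, rfl⟩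
  · intro a ha hya
    obtain ⟨j, hj1, hj2, hj3, rfl⟩ := C.conf_adj hc h1 h2 ha hya
    exact ⟨j, (h j hj1 hj2 hj3 hya).1, rfl⟩

/-- No internal cap of length at least two inside a cap of length at most eight. -/
theorem no_inner (C : Core G x D u) {k m : ℤ} (hc : Cap G x D u k m) (hm : m ≤ k + 8) :
    ∀ n : ℕ, ∀ i j : ℤ, k < i → j < m → i + 2 ≤ j → (j - i).toNat = n → ¬ Cap G x D u i j := by
  intro n
  induction n using Nat.strong_induction_on with
  | _ n ih =>
    intro i j hi hj hij hn hcap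
    have hD := hc.2.1
    refine C.short hc hm (y := i + 1) (by omega) (by omega) {i, i + 2} Finset.card_le_two ?_
    intro l hl1 hl2 hl3 hl4
    obtain ⟨l', g1, g2, g3, g4⟩ := C.conf_adj hcap (y := i + 1) (by omega) (by omega) (C.adj l) hl4
    have : l' = l := by
      rcases le_total l l' with h | h
      · exact (C.inj l l' h (by omega) g4.symm).symm
      · exact C.inj l' l h (by omega) g4
    subst this
    refine ⟨?_, by omega, by omega⟩
    by_contra hne
    simp only [Finset.mem_insert, Finset.mem_singleton, not_or] at hne
    have h5 : i + 1 + 2 ≤ l' := by omega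
    exact ih (l' - (i + 1)).toNat (by omega) (i + 1) l' (by omega) (by omega) h5 rfl
      (C.edge_cap (by omega) (by omega) hl4)

/-- In a cap of length at most eight, every interior vertex sees one of the two ends. -/
theorem sees_end (C : Core G x D u) {k m y : ℤ} (hc : Cap G x D u k m) (hm : m ≤ k + 8)
    (h1 : k < y) (h2 : y < m) : G.Adj (u k) (u y) ∨ G.Adj (u y) (u m) := by
  by_contra hcon
  rw [not_or] at hcon
  have hD := hc.2.1
  refine C.short hc hm h1 h2 {y - 1, y + 1} Finset.card_le_two ?_
  intro j hj1 hj2 hj3 hj4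
  have hjk : j ≠ k := by rintro rfl; exact hcon.1 hj4.symm
  have hjm : j ≠ m := by rintro rfl; exact hcon.2 hj4
  refine ⟨?_, by omega, by omega⟩
  by_contra hne
  simp only [Finset.mem_insert, Finset.mem_singleton, not_or] at hne
  rcases lt_or_gt_of_ne hj3 with h | h
  · exact C.no_inner hc hm _ j y (by omega) (by omega) (by omega) rfl
      (C.edge_cap (by omega) (by omega) hj4.symm)
  · exact C.no_inner hc hm _ y j (by omega) (by omega) (by omega) rfl
      (C.edge_cap (by omega) (by omega) hj4)

theorem second_left (C : Core G x D u) {k m : ℤ} (hc : Cap G x D u k m) (hm : m ≤ k + 8)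
    (hm4 : k + 4 ≤ m) (h : G.Adj (u k) (u (k + 2))) : G.Adj (u (k + 2)) (u m) := by
  by_contra hcon
  have hD := hc.2.1
  have hcap := C.edge_cap (i := k) (j := k + 2) (by omega) (by omega) h
  refine C.starA (k + 1) (u k) (Finset.Icc k (k + 3)) {k + 2} (by simp; omega) ?_ ?_
  · intro a ha hcov
    rcases C.cov_cases hcap (y := k + 1) (by omega) (by omega) ha hcov with
      ⟨j, hj1, hj2, rfl, -⟩ | ⟨i, hi1, hi2, hi3, hi6, hi4, hi5⟩
    · exact ⟨j, Finset.mem_Icc.2 ⟨hj1, by omega⟩, rfl⟩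
    · have : i ≠ k := by rintro rfl; exact hi6 rfl
      obtain rfl : i = k + 2 := by omega
      obtain ⟨j, hj1, hj2, hj3, rfl⟩ := C.conf_adj hc (y := k + 2) (by omega) (by omega) ha hi5
      refine ⟨j, Finset.mem_Icc.2 ⟨hj1, ?_⟩, rfl⟩
      by_contra hgt
      have hjm : j ≠ m := by rintro rfl; exact hcon hi5
      exact C.no_inner hc hm _ (k + 2) j (by omega) (by omega) (by omega) rfl
        (C.edge_cap (by omega) (by omega) hi5)
  · intro a ha hya hne
    obtain ⟨j, hj1, hj2, hj3, rfl⟩ := C.conf_adj hcap (y := k + 1) (by omega) (by omega) ha hya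
    have : j ≠ k := by rintro rfl; exact hne rfl
    exact ⟨j, by simp; omega, rfl⟩

theorem second_right (C : Core G x D u) {k m : ℤ} (hc : Cap G x D u k m) (hm : m ≤ k + 8)
    (hm4 : k + 4 ≤ m) (h : G.Adj (u (m - 2)) (u m)) : G.Adj (u k) (u (m - 2)) := by
  have := C.reflect.second_left (cap_reflect hc) (by omega) (by omega)
    (by simpa [sub_eq_neg_add, add_comm] using h.symm)
  simpa [sub_eq_neg_add, add_comm] using this.symm

theorem second_both (C : Core G x D u) {k m : ℤ} (hc : Cap G x D u k m) (hm : m ≤ k + 8)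
    (hm4 : k + 4 ≤ m) : G.Adj (u (k + 2)) (u m) ∧ G.Adj (u k) (u (m - 2)) := by
  constructor
  · rcases C.sees_end hc hm (y := k + 2) (by omega) (by omega) with h | h
    · exact C.second_left hc hm hm4 h
    · exact h
  · rcases C.sees_end hc hm (y := m - 2) (by omega) (by omega) with h | h
    · exact h
    · exact C.second_right hc hm hm4 h

/-- Caps of length five to eight are impossible. -/
theorem no_mid (C : Core G x D u) {k m : ℤ} (hc : Cap G x D u k m) (hm : m ≤ k + 8)
    (hm5 : k + 5 ≤ m) : False := by
  obtain ⟨h1, h2⟩ := C.second_both hc hm (by omega)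
  have hD := hc.2.1
  exact C.nc_edge (i := k) (j := k + 2) (k := m - 2) (l := m) (by omega) (by omega) (by omega)
    (by omega) h2 h1

/-- A cap of length four forces its left end to be a hub. -/
theorem four_left (C : Core G x D u) {k : ℤ} (hc : Cap G x D u k (k + 4))
    (h : ∀ a, G.Adj x a → G.Adj (u k) a → ∃ j, k - 4 ≤ j ∧ j ≤ k + 4 ∧ u j = a) : False := by
  obtain ⟨-, h2⟩ := C.second_both hc (by omega) (by omega)
  have hD := hc.2.1
  rw [show k + 4 - 2 = k + 2 by ring] at h2
  have hcap := C.edge_cap (i := k) (j := k + 2) (by omega) (by omega) h2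
  refine C.starB (k + 1) (Finset.Icc (k - 4) (k + 4)) {k, k + 2} ?_ ?_ ?_
  · have : ({k, k + 2} : Finset ℤ).card ≤ 2 := Finset.card_le_two
    simp only [Int.card_Icc]; omega
  · intro a ha hcov
    rcases C.cov_cases hcap (y := k + 1) (by omega) (by omega) ha hcov with
      ⟨j, hj1, hj2, rfl, -⟩ | ⟨i, hi1, hi2, hi3, -, hi4, hi5⟩
    · exact ⟨j, Finset.mem_Icc.2 ⟨by omega, by omega⟩, rfl⟩
    · obtain rfl | rfl : i = k ∨ i = k + 2 := by omega
      · obtain ⟨j, hj1, hj2, rfl⟩ := h a ha hi5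
        exact ⟨j, Finset.mem_Icc.2 ⟨by omega, by omega⟩, rfl⟩
      · obtain ⟨j, hj1, hj2, hj3, rfl⟩ := C.conf_adj hc (y := k + 2) (by omega) (by omega) ha hi5
        exact ⟨j, Finset.mem_Icc.2 ⟨by omega, by omega⟩, rfl⟩
  · intro a ha hya
    obtain ⟨j, hj1, hj2, hj3, rfl⟩ := C.conf_adj hcap (y := k + 1) (by omega) (by omega) ha hya
    exact ⟨j, by simp; omega, rfl⟩

theorem four_right (C : Core G x D u) {k : ℤ} (hc : Cap G x D u k (k + 4))
    (h : ∀ a, G.Adj x a → G.Adj (u (k + 4)) a → ∃ j, k ≤ j ∧ j ≤ k + 8 ∧ u j = a) : False := by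
  have hc' := cap_reflect hc
  rw [show -k = -(k + 4) + 4 by ring] at hc'
  refine C.reflect.four_left hc' ?_
  intro a ha hka
  obtain ⟨j, h1, h2, rfl⟩ := h a ha (by simpa using hka)
  exact ⟨-j, by omega, by omega, by simp⟩

/-- In a cap of length three the interior vertices see both ends. -/
theorem three_both (C : Core G x D u) {k y : ℤ} (hc : Cap G x D u k (k + 3)) (h1 : k < y)
    (h2 : y < k + 3) : G.Adj (u y) (u k) ∧ G.Adj (u y) (u (k + 3)) := by
  have hD := hc.2.1
  have main : ∀ p q : ℤ, ((p = k ∧ q = k + 3) ∨ (p = k + 3 ∧ q = k)) → G.Adj (u y) (u q) := by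
    intro p q hpq
    by_contra hcon
    refine C.starA y (u p) (Finset.Icc k (k + 3)) {2 * k + 3 - y} (by simp; omega) ?_ ?_
    · intro a ha hcov
      rcases C.cov_cases hc h1 h2 ha hcov with
        ⟨j, hj1, hj2, rfl, -⟩ | ⟨i, hi1, hi2, hi3, hi6, hi4, hi5⟩
      · exact ⟨j, Finset.mem_Icc.2 ⟨hj1, hj2⟩, rfl⟩
      · have g1 : i ≠ p := by rintro rfl; exact hi6 rfl
        have g2 : i ≠ q := by rintro rfl; exact hcon hi4
        obtain ⟨j, hj1, hj2, -, rfl⟩ := C.conf_adj hc (y := i) (by omega) (by omega) ha hi5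
        exact ⟨j, Finset.mem_Icc.2 ⟨hj1, hj2⟩, rfl⟩
    · intro a ha hya hne
      obtain ⟨j, hj1, hj2, hj3, rfl⟩ := C.conf_adj hc h1 h2 ha hya
      have g1 : j ≠ p := by rintro rfl; exact hne rfl
      have g2 : j ≠ q := by rintro rfl; exact hcon hya
      exact ⟨j, by simp; omega, rfl⟩
  exact ⟨main (k + 3) k (Or.inr ⟨rfl, rfl⟩), main k (k + 3) (Or.inl ⟨rfl, rfl⟩)⟩

theorem no_three (C : Core G x D u) {k : ℤ} (hc : Cap G x D u k (k + 3)) : False := by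
  have hD := hc.2.1
  have a := (C.three_both hc (y := k + 1) (by omega) (by omega)).2
  have b := (C.three_both hc (y := k + 2) (by omega) (by omega)).1
  exact C.nc_edge (i := k) (j := k + 1) (k := k + 2) (l := k + 3) (by omega) (by omega) (by omega)
    (by omega) b.symm a

/-- First condition at a cap of length two. -/
theorem two_right (C : Core G x D u) {k : ℤ} (hc : Cap G x D u k (k + 2))
    (h : ∀ a, G.Adj x a → G.Adj (u (k + 2)) a → ∃ j, k ≤ j ∧ j ≤ k + 3 ∧ u j = a) : False := by
  have hD := hc.2.1
  refine C.starA (k + 1) (u k) (Finset.Icc k (k + 3)) {k + 2} (by simp; omega) ?_ ?_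
  · intro a ha hcov
    rcases C.cov_cases hc (y := k + 1) (by omega) (by omega) ha hcov with
      ⟨j, hj1, hj2, rfl, -⟩ | ⟨i, hi1, hi2, hi3, hi6, hi4, hi5⟩
    · exact ⟨j, Finset.mem_Icc.2 ⟨hj1, by omega⟩, rfl⟩
    · have g1 : i ≠ k := by rintro rfl; exact hi6 rfl
      obtain rfl : i = k + 2 := by omega
      obtain ⟨j, hj1, hj2, rfl⟩ := h a ha hi5
      exact ⟨j, Finset.mem_Icc.2 ⟨hj1, hj2⟩, rfl⟩
  · intro a ha hya hne
    obtain ⟨j, hj1, hj2, hj3, rfl⟩ := C.conf_adj hc (y := k + 1) (by omega) (by omega) ha hya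
    have g1 : j ≠ k := by rintro rfl; exact hne rfl
    exact ⟨j, by simp; omega, rfl⟩

theorem two_left (C : Core G x D u) {k : ℤ} (hc : Cap G x D u k (k + 2))
    (h : ∀ a, G.Adj x a → G.Adj (u k) a → ∃ j, k - 1 ≤ j ∧ j ≤ k + 2 ∧ u j = a) : False := by
  have hc' := cap_reflect hc
  rw [show -k = -(k + 2) + 2 by ring] at hc'
  refine C.reflect.two_right hc' ?_
  intro a ha hka
  obtain ⟨j, h1, h2, rfl⟩ := h a ha (by simpa using hka)
  exact ⟨-j, by omega, by omega, by simp⟩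

/-- Second condition at a cap of length two. -/
theorem two_both (C : Core G x D u) {k : ℤ} (hc : Cap G x D u k (k + 2))
    (h : ∀ a, G.Adj x a → G.Adj (u k) a ∨ G.Adj (u (k + 2)) a →
      ∃ j, k - 2 ≤ j ∧ j ≤ k + 4 ∧ u j = a) : False := by
  have hD := hc.2.1
  refine C.starB (k + 1) (Finset.Icc (k - 2) (k + 4)) {k, k + 2} ?_ ?_ ?_
  · have : ({k, k + 2} : Finset ℤ).card ≤ 2 := Finset.card_le_two
    simp only [Int.card_Icc]; omega
  · intro a ha hcov
    rcases C.cov_cases hc (y := k + 1) (by omega) (by omega) ha hcov with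
      ⟨j, hj1, hj2, rfl, -⟩ | ⟨i, hi1, hi2, hi3, -, hi4, hi5⟩
    · exact ⟨j, Finset.mem_Icc.2 ⟨by omega, by omega⟩, rfl⟩
    · obtain rfl | rfl : i = k ∨ i = k + 2 := by omega
      · obtain ⟨j, hj1, hj2, rfl⟩ := h a ha (Or.inl hi5)
        exact ⟨j, Finset.mem_Icc.2 ⟨hj1, hj2⟩, rfl⟩
      · obtain ⟨j, hj1, hj2, rfl⟩ := h a ha (Or.inr hi5)
        exact ⟨j, Finset.mem_Icc.2 ⟨hj1, hj2⟩, rfl⟩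
  · intro a ha hya
    obtain ⟨j, hj1, hj2, hj3, rfl⟩ := C.conf_adj hc (y := k + 1) (by omega) (by omega) ha hya
    exact ⟨j, by simp; omega, rfl⟩

/-- A long minimal cap has only trivial caps inside. -/
theorem long_trivial (C : Core G x D u) {k m : ℤ} (hc : Cap G x D u k m) (hm : k + 9 ≤ m)
    (hmin : ∀ i j, k ≤ i → j ≤ m → j - i < m - k → Cap G x D u i j → j ≤ i + 4) :
    ∀ i j, k ≤ i → j ≤ m → j - i < m - k → Cap G x D u i j → j ≤ i + 1 := by
  have hD := hc.2.1
  -- neighbours of interior vertices are close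
  have close : ∀ r : ℤ, 2 ≤ r → (∀ i j, k ≤ i → j ≤ m → j - i < m - k → Cap G x D u i j →
      j ≤ i + r) → ∀ y a, k < y → y < m → G.Adj x a → G.Adj (u y) a →
      ∃ j, y - r ≤ j ∧ j ≤ y + r ∧ k ≤ j ∧ j ≤ m ∧ u j = a := by
    intro r hr hR y a h1 h2 ha hya
    obtain ⟨j, hj1, hj2, hj3, rfl⟩ := C.conf_adj hc h1 h2 ha hya
    refine ⟨j, ?_, ?_, hj1, hj2, rfl⟩
    · by_contra hlt
      have := hR j y hj1 h2.le (by omega) (C.edge_cap (by omega) (by omega) hya.symm)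
      omega
    · by_contra hlt
      have := hR y j h1.le hj2 (by omega) (C.edge_cap (by omega) (by omega) hya)
      omega
  have no4 : ∀ i, k ≤ i → i + 4 ≤ m → ¬ Cap G x D u i (i + 4) := by
    intro i hi1 hi2 hcap
    rcases eq_or_lt_of_le hi1 with rfl | hlt
    · refine C.four_right hcap ?_
      intro a ha hka
      obtain ⟨j, h1, h2, -, -, rfl⟩ := close 4 (by omega) hmin (k + 4) a (by omega) (by omega) ha hka
      exact ⟨j, by omega, by omega, rfl⟩
    · refine C.four_left hcap ?_
      intro a ha hka
      obtain ⟨j, h1, h2, -, -, rfl⟩ := close 4 (by omega) hmin i a (by omega) (by omega) ha hka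
      exact ⟨j, by omega, by omega, rfl⟩
  have h2 : ∀ i j, k ≤ i → j ≤ m → j - i < m - k → Cap G x D u i j → j ≤ i + 2 := by
    intro i j hi hj hij hcap
    have := hmin i j hi hj hij hcap
    by_contra hgt
    obtain rfl | rfl : j = i + 3 ∨ j = i + 4 := by omega
    · exact C.no_three hcap
    · exact no4 i hi hj hcap
  have int2 : ∀ i, k < i → i + 2 < m → ¬ Cap G x D u i (i + 2) := by
    intro i hi1 hi2 hcap
    refine C.two_both hcap ?_
    intro a ha hka
    rcases hka with hka | hka
    · obtain ⟨j, h1, h2, -, -, rfl⟩ := close 2 le_rfl h2 i a (by omega) (by omega) ha hka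
      exact ⟨j, by omega, by omega, rfl⟩
    · obtain ⟨j, h1, h2, -, -, rfl⟩ := close 2 le_rfl h2 (i + 2) a (by omega) (by omega) ha hka
      exact ⟨j, by omega, by omega, rfl⟩
  intro i j hi hj hij hcap
  have h3 := h2 i j hi hj hij hcap
  by_contra hgt
  obtain rfl : j = i + 2 := by omega
  rcases eq_or_lt_of_le hi with rfl | hlt
  · refine C.two_right hcap ?_
    intro a ha hka
    obtain ⟨j, h1, h2, h3, h4, rfl⟩ := close 2 le_rfl h2 (k + 2) a (by omega) (by omega) ha hka
    refine ⟨j, h3, ?_, rfl⟩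
    by_contra hgt
    obtain rfl : j = k + 2 + 2 := by omega
    exact int2 (k + 2) (by omega) (by omega) (C.edge_cap (by omega) (by omega) hka)
  · rcases eq_or_lt_of_le hj with h5 | hlt'
    · refine C.two_left hcap ?_
      intro a ha hka
      obtain ⟨j, h1, h2, h3, h4, rfl⟩ := close 2 le_rfl h2 i a (by omega) (by omega) ha hka
      refine ⟨j, ?_, by omega, rfl⟩
      by_contra hgt
      obtain rfl : i = j + 2 := by omega
      exact int2 j (by omega) (by omega) (C.edge_cap (by omega) (by omega) hka.symm)
    · exact int2 i hlt hlt' hcap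

/-- A long cap with only trivial caps inside is impossible. -/
theorem no_long (C : Core G x D u) {k m : ℤ} (hc : Cap G x D u k m) (hm : k + 9 ≤ m)
    (ht : ∀ i j, k ≤ i → j ≤ m → j - i < m - k → Cap G x D u i j → j ≤ i + 1) : False := by
  have hD := hc.2.1
  have close : ∀ y a, k < y → y < m → G.Adj x a → G.Adj (u y) a →
      ∃ j, y - 1 ≤ j ∧ j ≤ y + 1 ∧ j ≠ y ∧ u j = a := by
    intro y a h1 h2 ha hya
    obtain ⟨j, hj1, hj2, hj3, rfl⟩ := C.conf_adj hc h1 h2 ha hya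
    refine ⟨j, ?_, ?_, hj3, rfl⟩
    · by_contra hlt
      have := ht j y hj1 h2.le (by omega) (C.edge_cap (by omega) (by omega) hya.symm)
      omega
    · by_contra hlt
      have := ht y j h1.le hj2 (by omega) (C.edge_cap (by omega) (by omega) hya)
      omega
  -- connectors at interior vertices are contiguous
  have contig : ∀ y e a b l, k < y → y < m → (y = a ∨ y = b) → k ≤ a → b ≤ m → a < l → l < b →
      CInc G x e (u a) → CInc G x e (u b) → CInc G x e (u l) := by
    intro y e a b l hy1 hy2 hy ha hb hl1 hl2 hea heb
    by_contra hcon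
    obtain ⟨a', b', g1, g2, g3, g4, g5, -⟩ := C.gap hl1 hl2 (by omega) hea heb hcon
    have := ht a' b' (by omega) (by omega) (by omega) g5
    omega
  obtain ⟨w, hw1, hw2⟩ : ∃ w, CInc G x (Sum.inl w) (u (k + 2)) ∧
      CInc G x (Sum.inl w) (u (k + 9)) := by
    by_contra hcon
    refine C.starB (k + 2) (Finset.Icc k (k + 8)) {k + 1, k + 3} ?_ ?_ ?_
    · have : ({k + 1, k + 3} : Finset ℤ).card ≤ 2 := Finset.card_le_two
      simp only [Int.card_Icc]; omega
    · intro a ha hcov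
      rcases C.cov_cases hc (y := k + 2) (by omega) (by omega) ha hcov with
        ⟨j, hj1, hj2, rfl, hj⟩ | ⟨i, hi1, hi2, hi3, -, hi4, hi5⟩
      · refine ⟨j, Finset.mem_Icc.2 ⟨hj1, ?_⟩, rfl⟩
        by_contra hgt
        rcases hj with rfl | hj | ⟨w, -, hw1, hw2⟩
        · omega
        · have := ht (k + 2) j (by omega) (by omega) (by omega)
            (C.edge_cap (by omega) (by omega) hj)
          omega
        · rcases eq_or_lt_of_le (show k + 9 ≤ j by omega) with h | h
          · rw [← h] at hw2
            exact hcon ⟨w, hw1, hw2⟩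
          · exact hcon ⟨w, hw1, contig (k + 2) _ (k + 2) j (k + 9) (by omega) (by omega)
              (Or.inl rfl) (by omega) (by omega) (by omega) (by omega) hw1 hw2⟩
      · have hi : i = k + 1 ∨ i = k + 3 := by
          rcases lt_or_gt_of_ne hi3 with h | h
          · have := ht i (k + 2) (by omega) (by omega) (by omega)
              (C.edge_cap (by omega) (by omega) hi4.symm)
            omega
          · have := ht (k + 2) i (by omega) (by omega) (by omega)
              (C.edge_cap (by omega) (by omega) hi4)
            omega
        obtain ⟨j, hj1, hj2, -, rfl⟩ := close i a (by omega) (by omega) ha hi5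
        exact ⟨j, Finset.mem_Icc.2 ⟨by omega, by omega⟩, rfl⟩
    · intro a ha hya
      obtain ⟨j, hj1, hj2, hj3, rfl⟩ := close (k + 2) a (by omega) (by omega) ha hya
      exact ⟨j, by simp; omega, rfl⟩
  have hw : ∀ l, k + 2 ≤ l → l ≤ k + 9 → CInc G x (Sum.inl w) (u l) := by
    intro l h1 h2
    rcases eq_or_lt_of_le h1 with rfl | h1
    · exact hw1
    · rcases eq_or_lt_of_le h2 with rfl | h2
      · exact hw2
      · exact contig (k + 2) _ (k + 2) (k + 9) l (by omega) (by omega) (Or.inl rfl) (by omega)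
          (by omega) h1 h2 hw1 hw2
  have hother : ∀ w' j, w' ≠ w → CInc G x (Sum.inl w') (u (k + 5)) → k ≤ j → j ≤ m →
      CInc G x (Sum.inl w') (u j) → k + 4 ≤ j ∧ j ≤ k + 6 := by
    intro w' j hne h5 hj1 hj2 hj
    have hne' : (Sum.inl w : V ⊕ Sym2 V) ≠ Sum.inl w' := fun h => hne (Sum.inl.inj h).symm
    constructor
    · by_contra hlt
      have h3 : CInc G x (Sum.inl w') (u (k + 3)) := by
        rcases eq_or_lt_of_le (show j ≤ k + 3 by omega) with rfl | h
        · exact hj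
        · exact contig (k + 5) _ j (k + 5) (k + 3) (by omega) (by omega) (Or.inr rfl) (by omega)
            (by omega) (by omega) (by omega) hj h5
      exact C.nc _ _ (k + 3) (k + 4) (k + 5) (k + 9) (by omega) (by omega) (by omega) (by omega)
        hne'.symm h3 h5 (hw _ (by omega) (by omega)) (hw _ (by omega) (by omega))
    · by_contra hlt
      have h7 : CInc G x (Sum.inl w') (u (k + 7)) := by
        rcases eq_or_lt_of_le (show k + 7 ≤ j by omega) with h | h
        · rw [h]; exact hj
        · exact contig (k + 5) _ (k + 5) j (k + 7) (by omega) (by omega) (Or.inl rfl) (by omega)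
            (by omega) (by omega) (by omega) h5 hj
      exact C.nc _ _ (k + 2) (k + 5) (k + 6) (k + 7) (by omega) (by omega) (by omega) (by omega)
        hne' (hw _ (by omega) (by omega)) (hw _ (by omega) (by omega)) h5 h7
  -- generic covering at `k + 5`
  have cov5 : ∀ S : Finset ℤ, k + 4 ∈ S → k + 5 ∈ S → k + 6 ∈ S →
      (G.Adj (u (k + 5)) (u (k + 4)) → k + 3 ∈ S) → (G.Adj (u (k + 5)) (u (k + 6)) → k + 7 ∈ S) →
      ∀ a, G.Adj x a → CCov G x (u (k + 5)) w a → ∃ j ∈ S, u j = a := by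
    intro S s4 s5 s6 s3 s7 a ha hcov
    rcases C.cov_cases hc (y := k + 5) (by omega) (by omega) ha hcov with
      ⟨j, hj1, hj2, rfl, hj⟩ | ⟨i, hi1, hi2, hi3, -, hi4, hi5⟩
    · have : k + 4 ≤ j ∧ j ≤ k + 6 := by
        rcases hj with rfl | hj | ⟨w', hne, h5, hj⟩
        · omega
        · obtain ⟨j', g1, g2, g3, g4⟩ := close (k + 5) (u j) (by omega) (by omega) (C.adj j) hj
          have : j' = j := by
            rcases le_total j j' with h | h
            · exact (C.inj j j' h (by omega) g4.symm).symm
            · exact C.inj j' j h (by omega) g4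
          omega
        · exact hother w' j hne h5 hj1 hj2 hj
      obtain rfl | rfl | rfl : j = k + 4 ∨ j = k + 5 ∨ j = k + 6 := by omega
      exacts [⟨_, s4, rfl⟩, ⟨_, s5, rfl⟩, ⟨_, s6, rfl⟩]
    · obtain ⟨i', g1, g2, g3, g4⟩ := close (k + 5) (u i) (by omega) (by omega) (C.adj i) hi4
      rw [← g4] at hi4 hi5
      obtain rfl | rfl : i' = k + 4 ∨ i' = k + 6 := by omega
      · obtain ⟨j, hj1, hj2, hj3, rfl⟩ := close (k + 4) a (by omega) (by omega) ha hi5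
        obtain rfl | rfl : j = k + 3 ∨ j = k + 5 := by omega
        exacts [⟨_, s3 hi4, rfl⟩, ⟨_, s5, rfl⟩]
      · obtain ⟨j, hj1, hj2, hj3, rfl⟩ := close (k + 6) a (by omega) (by omega) ha hi5
        obtain rfl | rfl : j = k + 5 ∨ j = k + 7 := by omega
        exacts [⟨_, s5, rfl⟩, ⟨_, s7 hi4, rfl⟩]
  have nb5 : ∀ a, G.Adj x a → G.Adj (u (k + 5)) a → a = u (k + 4) ∨ a = u (k + 6) := by
    intro a ha h
    obtain ⟨j, hj1, hj2, hj3, rfl⟩ := close (k + 5) a (by omega) (by omega) ha h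
    obtain rfl | rfl : j = k + 4 ∨ j = k + 6 := by omega
    exacts [Or.inl rfl, Or.inr rfl]
  by_cases h4 : G.Adj (u (k + 5)) (u (k + 4))
  · by_cases h6 : G.Adj (u (k + 5)) (u (k + 6))
    · refine C.starA4 (k + 5) w (Finset.Icc (k + 3) (k + 7)) {k + 4, k + 6} ?_ ?_
        (cov5 _ ?_ ?_ ?_ ?_ ?_) ?_
      · have : ({k + 4, k + 6} : Finset ℤ).card ≤ 2 := Finset.card_le_two
        simp only [Int.card_Icc]; omega
      · classical
        have h5 := hw (k + 5) (by omega) (by omega)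
        have hsub : ({x, w, u (k + 4), u (k + 6)} : Finset V) ⊆ G.neighborFinset (u (k + 5)) := by
          intro z hz
          simp only [Finset.mem_insert, Finset.mem_singleton] at hz
          rw [SimpleGraph.mem_neighborFinset]
          rcases hz with rfl | rfl | rfl | rfl
          exacts [(C.adj _).symm, h5.1.symm, h4, h6]
        have hcard : ({x, w, u (k + 4), u (k + 6)} : Finset V).card = 4 := by
          have n46 : u (k + 4) ≠ u (k + 6) := fun h => by
            have := C.inj _ _ (by omega) (by omega) h; omega
          have w4 : w ≠ u (k + 4) := by rintro rfl; exact h5.2.1 (C.adj _)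
          have w6 : w ≠ u (k + 6) := by rintro rfl; exact h5.2.1 (C.adj _)
          have x4 := (C.adj (k + 4)).ne
          have x6 := (C.adj (k + 6)).ne
          have xw := h5.2.2.symm
          rw [Finset.card_insert_of_notMem (by simp [xw, x4, x6]),
            Finset.card_insert_of_notMem (by simp [w4, w6]), Finset.card_pair n46]
        rw [← SimpleGraph.card_neighborFinset_eq_degree, ← hcard]
        exact Finset.card_le_card hsub
      · simp
      · simp
      · simp
      · simp
      · simp
      · intro a ha h _
        rcases nb5 a ha h with rfl | rfl
        exacts [⟨_, by simp, rfl⟩, ⟨_, by simp, rfl⟩]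
    · refine C.starA (k + 5) w (Finset.Icc (k + 3) (k + 6)) {k + 4} (by simp; omega)
        (cov5 _ (by simp) (by simp) (by simp) (by simp) (fun h => absurd h h6)) ?_
      intro a ha h _
      rcases nb5 a ha h with rfl | rfl
      exacts [⟨_, by simp, rfl⟩, absurd h h6]
  · refine C.starA (k + 5) w (Finset.Icc (k + 4) (k + 7)) {k + 6} (by simp; omega)
        (cov5 _ (by simp) (by simp) (by simp) (fun h => absurd h h4) (by simp)) ?_
    intro a ha h _
    rcases nb5 a ha h with rfl | rfl
    exacts [absurd h h4, ⟨_, by simp, rfl⟩]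

/-- Every cap has length at most four. -/
theorem all_short (C : Core G x D u) : ∀ n : ℕ, ∀ k m : ℤ, (m - k).toNat = n →
    Cap G x D u k m → m ≤ k + 4 := by
  intro n
  induction n using Nat.strong_induction_on with
  | _ n ih =>
    intro k m hn hc
    by_contra hgt
    by_cases h8 : m ≤ k + 8
    · exact C.no_mid hc h8 (by omega)
    · have hmin : ∀ i j, k ≤ i → j ≤ m → j - i < m - k → Cap G x D u i j → j ≤ i + 4 :=
        fun i j hi hj hij hcap => ih (j - i).toNat (by omega) i j rfl hcap
      exact C.no_long hc (by omega) (C.long_trivial hc (by omega) hmin)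

theorem contradiction (C : Core G x D u) : False := by
  have hD := C.hD
  have hs : ∀ k m, Cap G x D u k m → m ≤ k + 4 := fun k m h => C.all_short _ k m rfl h
  have noedge : ∀ i a, G.Adj x a → ¬ G.Adj (u i) a := by
    intro i a ha h
    obtain ⟨j, hj1, hj2, rfl⟩ := C.surj a ha i
    have hne : i ≠ j := by rintro rfl; exact h.ne rfl
    have h1 := hs _ _ (C.edge_cap (by omega) hj2 h)
    have h2 := hs _ _ (C.edge_cap (i := j) (j := i + D) (by omega) (by omega)
      (by rw [C.per]; exact h.symm))
    omega
  -- a connector at two different vertices is incident with everything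
  have full : ∀ w j, 0 < j → j < D → CInc G x (Sum.inl w) (u 0) → CInc G x (Sum.inl w) (u j) →
      ∀ l, 0 ≤ l → l < D → CInc G x (Sum.inl w) (u l) := by
    intro w j hj1 hj2 h0 hj l hl1 hl2
    by_contra hl
    have hl0 : l ≠ 0 := by rintro rfl; exact hl h0
    have hlj : l ≠ j := by rintro rfl; exact hl hj
    have hD' : CInc G x (Sum.inl w) (u D) := by
      have := C.per 0
      rw [zero_add] at this
      rwa [this]
    obtain ⟨a, b, h1, h2, hcap⟩ : ∃ a b, a < l ∧ l < b ∧ Cap G x D u a b := by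
      rcases lt_or_gt_of_ne hlj with h | h
      · obtain ⟨a, b, -, h1, h2, -, h3, -⟩ := C.gap (a := 0) (b := j) (j := l) (by omega) h
          (by omega) h0 hj hl
        exact ⟨a, b, h1, h2, h3⟩
      · obtain ⟨a, b, -, h1, h2, -, h3, -⟩ := C.gap (a := j) (b := D) (j := l) h hl2
          (by omega) hj hD' hl
        exact ⟨a, b, h1, h2, h3⟩
    have := hs _ _ hcap
    refine C.short hcap (by omega) h1 h2 ∅ (by simp) ?_
    intro i _ _ _ h
    exact absurd h (noedge _ _ (C.adj i))
  have cov0 : ∀ e a, G.Adj x a → CCov G x (u 0) e a → a = u 0 ∨ ∃ w, w ≠ e ∧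
      CInc G x (Sum.inl w) (u 0) ∧ CInc G x (Sum.inl w) a := by
    intro e a ha hcov
    rcases hcov with rfl | h | ⟨z, hzx, hze, hyz, hza⟩
    · exact Or.inl rfl
    · exact absurd h (noedge _ _ ha)
    · by_cases hxz : G.Adj x z
      · exact absurd hyz (noedge _ _ hxz)
      · exact Or.inr ⟨z, hze, ⟨hyz.symm, hxz, hzx⟩, ⟨hza, hxz, hzx⟩⟩
  obtain ⟨w, hw⟩ : ∃ w, ∀ l, 0 ≤ l → l < D → CInc G x (Sum.inl w) (u l) := by
    by_contra hcon
    refine C.starB 0 {0} ∅ (by simp) ?_ (fun a ha h => absurd h (noedge _ _ ha))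
    intro a ha hcov
    rcases cov0 _ a ha hcov with rfl | ⟨w, -, h0, hwa⟩
    · exact ⟨0, by simp, rfl⟩
    · obtain ⟨j, hj1, hj2, rfl⟩ := C.surj a ha 0
      rcases eq_or_lt_of_le hj1 with rfl | h
      · exact ⟨0, by simp, rfl⟩
      · exact absurd ⟨w, full w j h (by omega) h0 hwa⟩ hcon
  refine C.starA 0 w {0} ∅ (by simp) ?_ (fun a ha h _ => absurd h (noedge _ _ ha))
  intro a ha hcov
  rcases cov0 _ a ha hcov with rfl | ⟨w', hne, h0, hwa⟩
  · exact ⟨0, by simp, rfl⟩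
  · obtain ⟨j, hj1, hj2, rfl⟩ := C.surj a ha 0
    rcases eq_or_lt_of_le hj1 with rfl | h
    · exact ⟨0, by simp, rfl⟩
    · have hf := full w' j h (by omega) h0 hwa
      exact (C.nc (Sum.inl w) (Sum.inl w') 0 1 2 3 (by omega) (by omega) (by omega) (by omega)
        (fun h => hne (Sum.inl.inj h).symm) (hw 0 (by omega) (by omega)) (hw 2 (by omega) (by omega))
        (hf 1 (by omega) (by omega)) (hf 3 (by omega) (by omega))).elim

end Core
end CoreComb

section Curvature

theorem cv_lip (G : SimpleGraph V) (hconn : G.Connected) (f : V → ℝ)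
    (hf : ∀ a b, G.Adj a b → f b - f a ≤ 1) (a b : V) : f b - f a ≤ (G.dist a b : ℝ) := by
  obtain ⟨p, hp⟩ := hconn.exists_walk_length_eq_dist a b
  rw [← hp]
  clear hp
  induction p with
  | nil => simp
  | cons h p ih =>
    have := hf _ _ h
    simp only [SimpleGraph.Walk.length_cons]
    push_cast
    linarith

theorem cv_dual (G : SimpleGraph V) (m₁ m₂ : V → ℝ) (f : V → ℝ)
    (hf : ∀ a b, f b - f a ≤ (G.dist a b : ℝ)) (A : V → V → ℝ) (hA : IsCoupling m₁ m₂ A) :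
    ∑ᶠ v, m₂ v * f v - ∑ᶠ v, m₁ v * f v ≤ ∑ᶠ p : V × V, A p.1 p.2 * (G.dist p.1 p.2 : ℝ) := by
  classical
  obtain ⟨hfin, hpos, h1, h2⟩ := hA
  set s : Finset V := hfin.toFinset.image Prod.fst ∪ hfin.toFinset.image Prod.snd with hs
  have hin : ∀ a b, A a b ≠ 0 → a ∈ s ∧ b ∈ s := by
    intro a b hab
    have : (a, b) ∈ hfin.toFinset := by simpa using hab
    exact ⟨Finset.mem_union_left _ (Finset.mem_image_of_mem Prod.fst this),
      Finset.mem_union_right _ (Finset.mem_image_of_mem Prod.snd this)⟩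
  have e1 : ∀ a, m₁ a = ∑ b ∈ s, A a b := fun a => by
    rw [← h1, finsum_eq_sum_of_support_subset]
    intro b hb
    exact (hin a b hb).2
  have e2 : ∀ b, m₂ b = ∑ a ∈ s, A a b := fun b => by
    rw [← h2, finsum_eq_sum_of_support_subset]
    intro a ha
    exact (hin a b ha).1
  have e3 : ∑ᶠ v, m₁ v * f v = ∑ a ∈ s, ∑ b ∈ s, A a b * f a := by
    rw [finsum_eq_sum_of_support_subset (s := s)]
    · refine Finset.sum_congr rfl fun a _ => ?_
      rw [e1, Finset.sum_mul]
    · intro a ha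
      by_contra hc
      apply ha
      have : m₁ a = 0 := by
        rw [e1]
        refine Finset.sum_eq_zero fun b _ => ?_
        by_contra h
        exact hc (hin a b h).1
      simp [this]
  have e4 : ∑ᶠ v, m₂ v * f v = ∑ a ∈ s, ∑ b ∈ s, A a b * f b := by
    rw [Finset.sum_comm, finsum_eq_sum_of_support_subset (s := s)]
    · refine Finset.sum_congr rfl fun a _ => ?_
      rw [e2, Finset.sum_mul]
    · intro a ha
      by_contra hc
      apply ha
      have : m₂ a = 0 := by
        rw [e2]
        refine Finset.sum_eq_zero fun b _ => ?_
        by_contra h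
        exact hc (hin b a h).2
      simp [this]
  have e5 : ∑ᶠ p : V × V, A p.1 p.2 * (G.dist p.1 p.2 : ℝ)
      = ∑ a ∈ s, ∑ b ∈ s, A a b * (G.dist a b : ℝ) := by
    rw [finsum_eq_sum_of_support_subset (s := s ×ˢ s), Finset.sum_product]
    intro p hp
    have : A p.1 p.2 ≠ 0 := fun h => hp (by simp [h])
    have := hin _ _ this
    simp [this.1, this.2]
  rw [e3, e4, e5, ← Finset.sum_sub_distrib]
  refine Finset.sum_le_sum fun a _ => ?_
  rw [← Finset.sum_sub_distrib]
  refine Finset.sum_le_sum fun b _ => ?_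
  rw [← mul_sub]
  exact mul_le_mul_of_nonneg_left (hf a b) (hpos a b).1

theorem cv_lazy_sum (G : SimpleGraph V) [G.LocallyFinite] (α : ℝ) (x : V) (f : V → ℝ) :
    ∑ᶠ v, lazyWalk G α x v * f v =
      α * f x + (1 - α) / (G.degree x : ℝ) * ∑ v ∈ G.neighborFinset x, f v := by
  classical
  rw [finsum_eq_sum_of_support_subset (s := insert x (G.neighborFinset x))]
  · rw [Finset.sum_insert (by simp), Finset.mul_sum]
    congr 1
    · simp [lazyWalk]
    · refine Finset.sum_congr rfl fun v hv => ?_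
      rw [SimpleGraph.mem_neighborFinset] at hv
      simp [lazyWalk, hv, hv.ne']
  · intro v hv
    by_contra hc
    simp only [Finset.coe_insert, SimpleGraph.coe_neighborFinset, Set.mem_insert_iff,
      SimpleGraph.mem_neighborSet, not_or] at hc
    exact hv (by simp [lazyWalk, hc.1, hc.2])

theorem cv_coupling (G : SimpleGraph V) [G.LocallyFinite] (α : ℝ) (h0 : 0 ≤ α) (h1 : α ≤ 1)
    (x y : V) (hx : 0 < G.degree x) (hy : 0 < G.degree y) :
    IsCoupling (lazyWalk G α x) (lazyWalk G α y)
      (fun a b => lazyWalk G α x a * lazyWalk G α y b) := by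
  classical
  have one : ∀ z, 0 < G.degree z → ∑ᶠ v, lazyWalk G α z v = 1 := by
    intro z hz
    have := cv_lazy_sum G α z (fun _ => 1)
    simp only [mul_one, Finset.sum_const, SimpleGraph.card_neighborFinset_eq_degree,
      nsmul_eq_mul] at this
    rw [this]
    have : (G.degree z : ℝ) ≠ 0 := by positivity
    field_simp
    ring
  have bd : ∀ z v, 0 < G.degree z → 0 ≤ lazyWalk G α z v ∧ lazyWalk G α z v ≤ 1 := by
    intro z v hz
    have : (1 : ℝ) ≤ G.degree z := by exact_mod_cast hz
    unfold lazyWalk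
    split_ifs
    · exact ⟨h0, h1⟩
    · refine ⟨div_nonneg (by linarith) (by linarith), ?_⟩
      rw [div_le_one (by linarith)]
      linarith
    · simp
  have fin : ∀ z, (Function.support (lazyWalk G α z)).Finite := by
    intro z
    refine (insert z (G.neighborFinset z)).finite_toSet.subset ?_
    intro v hv
    by_contra hc
    simp only [Finset.coe_insert, SimpleGraph.coe_neighborFinset, Set.mem_insert_iff,
      SimpleGraph.mem_neighborSet, not_or] at hc
    exact hv (by simp [lazyWalk, hc.1, hc.2])
  refine ⟨((fin x).prod (fin y)).subset ?_, ?_, ?_, ?_⟩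
  · intro p hp
    exact ⟨left_ne_zero_of_mul hp, right_ne_zero_of_mul hp⟩
  · intro a b
    exact ⟨mul_nonneg (bd x a hx).1 (bd y b hy).1, mul_le_one₀ (bd x a hx).2 (bd y b hy).1
      (bd y b hy).2⟩
  · intro a
    rw [← mul_finsum _ _, one y hy, mul_one]
  · intro b
    rw [← finsum_mul _ _, one x hx, one_mul]

theorem cv_main (G : SimpleGraph V) [G.LocallyFinite] (hconn : G.Connected)
    (hpos : PositivelyCurved G) (x y : V) (hxy : G.Adj x y) (f : V → ℝ)
    (hf : ∀ a b, G.Adj a b → f b - f a ≤ 1) (fx : f x = 0) (fy : f y = 1) :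
    0 < 1 + (∑ v ∈ G.neighborFinset x, f v) / (G.degree x : ℝ)
      - (∑ v ∈ G.neighborFinset y, f v) / (G.degree y : ℝ) := by
  obtain ⟨κ, hκ, hlim⟩ := hpos hxy
  refine lt_of_lt_of_le hκ ?_
  refine le_of_tendsto hlim ?_
  have hev : ∀ᶠ α : ℝ in nhdsWithin 1 (Set.Iio 1), 0 < α ∧ α < 1 := by
    refine Filter.Eventually.and ?_ self_mem_nhdsWithin
    exact nhdsWithin_le_nhds (lt_mem_nhds zero_lt_one)
  filter_upwards [hev] with α hα
  have hx : 0 < G.degree x := by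
    rw [SimpleGraph.degree_pos_iff_exists_adj]; exact ⟨y, hxy⟩
  have hy : 0 < G.degree y := by
    rw [SimpleGraph.degree_pos_iff_exists_adj]; exact ⟨x, hxy.symm⟩
  have hd : G.dist x y = 1 := SimpleGraph.dist_eq_one_iff_adj.mpr hxy
  have hW : α + (1 - α) * ((∑ v ∈ G.neighborFinset y, f v) / (G.degree y : ℝ)
      - (∑ v ∈ G.neighborFinset x, f v) / (G.degree x : ℝ)) ≤
      transportDist G (lazyWalk G α x) (lazyWalk G α y) := by
    refine le_csInf ⟨_, _, cv_coupling G α hα.1.le hα.2.le x y hx hy, rfl⟩ ?_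
    rintro w ⟨A, hA, rfl⟩
    refine le_trans (le_of_eq ?_) (cv_dual G _ _ f (cv_lip G hconn f hf) A hA)
    rw [cv_lazy_sum, cv_lazy_sum, fx, fy]
    ring
  rw [div_le_iff₀ (by linarith)]
  unfold alphaRicci
  rw [hd]
  simp only [Nat.cast_one, div_one]
  linarith

open Classical in
theorem cv_count (G : SimpleGraph V) [G.LocallyFinite] (hconn : G.Connected)
    (hpos : PositivelyCurved G) (x y : V) (hxy : G.Adj x y) (Z : Finset V)
    (hZ : ∀ z ∈ Z, G.Adj y z ∧ z ≠ x) (R : Finset V)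
    (hR : ∀ a, G.Adj x a → (a = y ∨ G.Adj y a ∨ ∃ z ∈ Z, G.Adj z a) → a ∈ R) :
    G.degree x * Z.card <
      G.degree y * (R.card + 1 + (Z.filter fun z => G.Adj x z).card) := by
  set N := G.neighborFinset x with hN
  let cov : V → Prop := fun a => a = y ∨ G.Adj y a ∨ ∃ z ∈ Z, G.Adj z a
  let f : V → ℝ := fun v => if v = y ∨ v ∈ Z then 1 else if G.Adj x v ∧ ¬ cov v then -1 else 0
  have hyZ : y ∉ Z := fun h => (hZ y h).1.ne rfl
  have fx : f x = 0 := by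
    have h1 : x ≠ y := hxy.ne
    have h2 : x ∉ Z := fun h => (hZ x h).2 rfl
    simp [f, h1, h2]
  have fy : f y = 1 := by simp [f]
  have hf : ∀ a b, G.Adj a b → f b - f a ≤ 1 := by
    intro a b hab
    by_cases hb : b = y ∨ b ∈ Z
    · have ha : ¬ (G.Adj x a ∧ ¬ cov a) := by
        rintro ⟨_, hc⟩
        apply hc
        rcases hb with rfl | hb
        · exact Or.inr (Or.inl hab.symm)
        · exact Or.inr (Or.inr ⟨b, hb, hab.symm⟩)
      simp only [f, if_pos hb, if_neg ha]
      split_ifs <;> norm_num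
    · simp only [f, if_neg hb]
      split_ifs <;> norm_num
  have main := cv_main G hconn hpos x y hxy f hf fx fy
  have hx : 0 < G.degree x := by
    rw [SimpleGraph.degree_pos_iff_exists_adj]; exact ⟨y, hxy⟩
  have hy : 0 < G.degree y := by
    rw [SimpleGraph.degree_pos_iff_exists_adj]; exact ⟨x, hxy.symm⟩
  have Sy : (Z.card : ℝ) ≤ ∑ v ∈ G.neighborFinset y, f v := by
    have h1 : ∀ v ∈ G.neighborFinset y, (if v ∈ Z then (1 : ℝ) else 0) ≤ f v := by
      intro v hv
      rw [SimpleGraph.mem_neighborFinset] at hv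
      have hc : ¬ (G.Adj x v ∧ ¬ cov v) := fun h => h.2 (Or.inr (Or.inl hv))
      simp only [f, if_neg hc]
      split_ifs <;> simp_all
    refine le_trans (le_of_eq ?_) (Finset.sum_le_sum h1)
    rw [Finset.sum_ite_mem, Finset.inter_eq_right.mpr]
    · simp
    · intro z hz
      simpa using (hZ z hz).1
  have Sx : ∑ v ∈ N, f v ≤
      1 + ((Z.filter fun z => G.Adj x z).card : ℝ) - ((G.degree x : ℝ) - R.card) := by
    have h1 : ∀ v ∈ N, f v ≤ (if v = y then (1 : ℝ) else 0) + (if v ∈ Z then (1 : ℝ) else 0)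
        - (1 - if v ∈ R then (1 : ℝ) else 0) := by
      intro v hv
      rw [hN, SimpleGraph.mem_neighborFinset] at hv
      by_cases hr : v ∈ R
      · simp only [f, if_pos hr]
        split_ifs <;> simp_all
      · have hc : ¬ cov v := fun h => hr (hR v hv h)
        have h2 : v ≠ y := fun h => hc (Or.inl h)
        have h3 : v ∉ Z := fun h => hc (Or.inr (Or.inl (hZ v h).1))
        simp [f, hr, hc, h2, h3, hv]
    refine le_trans (Finset.sum_le_sum h1) ?_
    rw [Finset.sum_sub_distrib, Finset.sum_add_distrib, Finset.sum_sub_distrib,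
      Finset.sum_ite_mem, Finset.sum_ite_mem, Finset.sum_ite_eq']
    have k1 : ((N ∩ R).card : ℝ) ≤ R.card := by
      exact_mod_cast Finset.card_le_card Finset.inter_subset_right
    have k2 : N ∩ Z = Z.filter fun z => G.Adj x z := by
      ext v; simp [hN, and_comm]
    have k3 : y ∈ N := by simpa [hN] using hxy
    have k4 : N.card = G.degree x := by simp [hN]
    rw [k2]
    simp only [k3, if_true, Finset.sum_const, nsmul_eq_mul, mul_one, k4]
    linarith
  have hx' : (0 : ℝ) < G.degree x := by exact_mod_cast hx
  have hy' : (0 : ℝ) < G.degree y := by exact_mod_cast hy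
  have m2 : 0 < 1 + (1 + ((Z.filter fun z => G.Adj x z).card : ℝ)
      - ((G.degree x : ℝ) - R.card)) / (G.degree x : ℝ) - (Z.card : ℝ) / (G.degree y : ℝ) := by
    have a1 := div_le_div_of_nonneg_right Sx hx'.le
    have a2 := div_le_div_of_nonneg_right Sy hy'.le
    linarith
  have m3 : (G.degree x : ℝ) * Z.card <
      G.degree y * (R.card + 1 + (Z.filter fun z => G.Adj x z).card) := by
    have : 1 + (1 + ((Z.filter fun z => G.Adj x z).card : ℝ)
      - ((G.degree x : ℝ) - R.card)) / (G.degree x : ℝ) - (Z.card : ℝ) / (G.degree y : ℝ)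
      = (G.degree y * (R.card + 1 + (Z.filter fun z => G.Adj x z).card)
        - (G.degree x : ℝ) * Z.card) / (G.degree x * G.degree y) := by
      field_simp
      ring
    rw [this, div_pos_iff_of_pos_right (by positivity)] at m2
    linarith
  exact_mod_cast m3

open Classical in
theorem cv_star (G : SimpleGraph V) [G.LocallyFinite] (hconn : G.Connected)
    (hpos : PositivelyCurved G) (x y e : V) (hxy : G.Adj x y) (hdx : 18 ≤ G.degree x)
    (u : ℤ → V) (S T : Finset ℤ)
    (hS : ∀ a, G.Adj x a → CCov G x y e a → ∃ j ∈ S, u j = a)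
    (hT : ∀ a, G.Adj x a → G.Adj y a → a ≠ e → ∃ j ∈ T, u j = a) (c : ℕ)
    (hc : G.degree y ≤ (((G.neighborFinset y).erase x).erase e).card + c) :
    18 * ((G.degree y : ℤ) - c) < G.degree y * (S.card + 1 + T.card : ℤ) := by
  have := cv_count G hconn hpos x y hxy (((G.neighborFinset y).erase x).erase e)
    (by intro z hz; simp at hz; exact ⟨hz.2.2, hz.2.1⟩) (S.image u)
    (by
      intro a ha hcov
      rw [Finset.mem_image]
      apply hS a ha
      rcases hcov with h | h | ⟨z, hz, h⟩
      · exact Or.inl h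
      · exact Or.inr (Or.inl h)
      · simp at hz
        exact Or.inr (Or.inr ⟨z, hz.2.1, hz.1, hz.2.2, h⟩))
  have h1 : (S.image u).card ≤ S.card := Finset.card_image_le
  have h2 : ((((G.neighborFinset y).erase x).erase e).filter fun z => G.Adj x z).card ≤ T.card := by
    refine le_trans (Finset.card_le_card (t := T.image u) ?_) Finset.card_image_le
    intro a ha
    simp at ha
    rw [Finset.mem_image]
    exact hT a ha.2 ha.1.2.2 ha.1.1
  have h3 : G.degree y ≤ (((G.neighborFinset y).erase x).erase e).card + c := by
    exact hc
  have h4 : 18 * (((G.neighborFinset y).erase x).erase e).card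
      < G.degree y * (S.card + 1 + T.card) := by
    refine lt_of_le_of_lt (Nat.mul_le_mul_right _ hdx) (lt_of_lt_of_le ?_
      (Nat.mul_le_mul_left _ (by omega :
        (S.image u).card + 1 + ((((G.neighborFinset y).erase x).erase e).filter
          fun z => G.Adj x z).card ≤ _)))
    convert this
  have h5 : (18 : ℤ) * ((((G.neighborFinset y).erase x).erase e).card : ℤ)
      < G.degree y * (S.card + 1 + T.card) := by exact_mod_cast h4
  have h6 : (G.degree y : ℤ) - c ≤ ((((G.neighborFinset y).erase x).erase e).card : ℤ) := by
    omega
  linarith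

theorem cv_star2 (G : SimpleGraph V) [G.LocallyFinite] (hconn : G.Connected)
    (hpos : PositivelyCurved G) (x y e : V) (hxy : G.Adj x y) (hdx : 18 ≤ G.degree x)
    (u : ℤ → V) (S T : Finset ℤ)
    (hS : ∀ a, G.Adj x a → CCov G x y e a → ∃ j ∈ S, u j = a)
    (hT : ∀ a, G.Adj x a → G.Adj y a → a ≠ e → ∃ j ∈ T, u j = a) :
    18 * ((G.degree y : ℤ) - 2) < G.degree y * (S.card + 1 + T.card : ℤ) := by
  classical
  have := cv_star G hconn hpos x y e hxy hdx u S T hS hT 2 (by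
    have h1 := Finset.pred_card_le_card_erase (s := (G.neighborFinset y).erase x) (a := e)
    have h2 := Finset.pred_card_le_card_erase (s := G.neighborFinset y) (a := x)
    have h3 := G.card_neighborFinset_eq_degree y
    convert (by omega : G.degree y ≤ (((G.neighborFinset y).erase x).erase e).card + 2))
  exact_mod_cast this

theorem cv_star1 (G : SimpleGraph V) [G.LocallyFinite] (hconn : G.Connected)
    (hpos : PositivelyCurved G) (x y : V) (hxy : G.Adj x y) (hdx : 18 ≤ G.degree x)
    (u : ℤ → V) (S T : Finset ℤ)
    (hS : ∀ a, G.Adj x a → CCov G x y x a → ∃ j ∈ S, u j = a)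
    (hT : ∀ a, G.Adj x a → G.Adj y a → ∃ j ∈ T, u j = a) :
    18 * ((G.degree y : ℤ) - 1) < G.degree y * (S.card + 1 + T.card : ℤ) := by
  classical
  have := cv_star G hconn hpos x y x hxy hdx u S T hS (fun a h1 h2 _ => hT a h1 h2) 1 (by
    have h2 := Finset.pred_card_le_card_erase (s := G.neighborFinset y) (a := x)
    have h3 := G.card_neighborFinset_eq_degree y
    rw [Finset.erase_idem]
    convert (by omega : G.degree y ≤ ((G.neighborFinset y).erase x).card + 1))
  exact_mod_cast this

end Curvature

section Plane

/-- The part of an arc after its last visit of a circle around its initial point. -/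
theorem pl_tail (g : Set.Icc (0:ℝ) 1 → ℂ) (hg : Continuous g) (x0 y0 : ℂ)
    (h0 : g ⟨0, Set.left_mem_Icc.mpr zero_le_one⟩ = x0)
    (h1 : g ⟨1, Set.right_mem_Icc.mpr zero_le_one⟩ = y0) (r : ℝ) (hr : 0 < r)
    (hy : r < ‖y0 - x0‖) :
    ∃ (Tl : Set ℂ) (p : ℂ), Tl ⊆ Set.range g ∧ IsPathConnected Tl ∧ y0 ∈ Tl ∧ p ∈ Tl ∧
      (∀ z ∈ Tl, r ≤ ‖z - x0‖) ∧ ‖p - x0‖ = r := by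
  set F : ℝ → ℂ := Set.IccExtend zero_le_one g with hF
  have hFc : Continuous F := hg.Icc_extend'
  have F0 : F 0 = x0 := by rw [hF, ← h0]; exact Set.IccExtend_left _ _
  have F1 : F 1 = y0 := by rw [hF, ← h1]; exact Set.IccExtend_right _ _
  have hN : Continuous fun t => ‖F t - x0‖ := by fun_prop
  have ivt : ∀ s, s ≤ 1 → ‖F s - x0‖ ≤ r → ∃ t ∈ Set.Icc s 1, ‖F t - x0‖ = r := by
    intro s hs hle
    have := intermediate_value_Icc hs hN.continuousOn (f := fun t => ‖F t - x0‖)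
    have hm : r ∈ Set.Icc ‖F s - x0‖ ‖F 1 - x0‖ := ⟨hle, by rw [F1]; exact hy.le⟩
    exact this hm
  have hK : IsCompact {t ∈ Set.Icc (0:ℝ) 1 | ‖F t - x0‖ = r} := by
    apply isCompact_Icc.inter_right (t := {t | ‖F t - x0‖ = r})
    exact isClosed_eq hN continuous_const
  have hne : {t ∈ Set.Icc (0:ℝ) 1 | ‖F t - x0‖ = r}.Nonempty := by
    obtain ⟨t, ht, h⟩ := ivt 0 zero_le_one (by simp [F0, hr.le])
    exact ⟨t, ht, h⟩
  obtain ⟨t, ⟨⟨ht0, ht1⟩, htr⟩, hmax⟩ := hK.exists_isGreatest hne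
  refine ⟨F '' Set.Icc t 1, F t, ?_, ?_, ⟨1, ⟨ht1, le_rfl⟩, F1⟩, ⟨t, ⟨le_rfl, ht1⟩, rfl⟩, ?_, htr⟩
  · rintro _ ⟨s, _, rfl⟩
    exact ⟨_, rfl⟩
  · exact ((convex_Icc t 1).isPathConnected ⟨t, le_rfl, ht1⟩).image hFc
  · rintro _ ⟨s, ⟨hs0, hs1⟩, rfl⟩
    by_contra hlt
    push Not at hlt
    obtain ⟨s', ⟨h3, h4⟩, h5⟩ := ivt s hs1 hlt.le
    have h6 : s' ≤ t := hmax ⟨⟨by linarith, h4⟩, h5⟩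
    have h7 : s = t := by linarith
    rw [h7, htr] at hlt
    exact lt_irrefl _ hlt

/-- The consequences of planarity that we need: `R u v` is the arc of the edge `uv`. -/
structure PlaneData (G : SimpleGraph V) (f : V → ℂ) (R : ∀ u v : V, G.Adj u v → Set ℂ) :
    Prop where
  pc : ∀ u v h, IsPathConnected (R u v h)
  closed : ∀ u v h, IsClosed (R u v h)
  left : ∀ u v h, f u ∈ R u v h
  right : ∀ u v h, f v ∈ R u v h
  inj : Function.Injective f
  avoid : ∀ u v h w, w ≠ u → w ≠ v → f w ∉ R u v h
  disj : ∀ u v h u' v' h', u ≠ u' → u ≠ v' → v ≠ u' → v ≠ v' →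
    ∀ z, z ∈ R u v h → z ∈ R u' v' h' → False
  meet : ∀ x a h b h', a ≠ b → ∀ z, z ∈ R x a h → z ∈ R x b h' → z = f x
  tail : ∀ x a h r, 0 < r → r < ‖f a - f x‖ → ∃ (Tl : Set ℂ) (p : ℂ), Tl ⊆ R x a h ∧
    IsPathConnected Tl ∧ f a ∈ Tl ∧ p ∈ Tl ∧ (∀ z ∈ Tl, r ≤ ‖z - f x‖) ∧ ‖p - f x‖ = r

theorem pl_data (G : SimpleGraph V) (hp : IsPlanar G) : ∃ f R, PlaneData G f R := by
  obtain ⟨f, e, hinj, hc, -, hend, hav, hmeet⟩ := hp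
  set φ := Complex.equivRealProdCLM.symm with hφ
  have φc : Continuous φ := φ.continuous
  have φi : Function.Injective φ := φ.injective
  have mem : ∀ u v h z, z ∈ Set.range (φ ∘ e u v h) → ∃ y ∈ Set.range (e u v h), φ y = z := by
    rintro u v h _ ⟨t, rfl⟩
    exact ⟨_, ⟨t, rfl⟩, rfl⟩
  have mem2 : ∀ u v h u' v' h', ({u, v} : Set V) ≠ {u', v'} → ∀ z,
      z ∈ Set.range (φ ∘ e u v h) → z ∈ Set.range (φ ∘ e u' v' h') →
      ∃ w, w ∈ ({u, v} : Set V) ∧ w ∈ ({u', v'} : Set V) ∧ z = φ (f w) := by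
    intro u v h u' v' h' hne z hz hz'
    obtain ⟨y, hy, rfl⟩ := mem _ _ _ _ hz
    obtain ⟨y', hy', he⟩ := mem _ _ _ _ hz'
    obtain rfl := φi he
    obtain ⟨⟨w, hw, rfl⟩, ⟨w', hw', he'⟩⟩ := hmeet u v h u' v' h' hne ⟨hy, hy'⟩
    obtain rfl := hinj he'
    exact ⟨w', hw, hw', rfl⟩
  refine ⟨fun v => φ (f v), fun u v h => Set.range (φ ∘ e u v h), ?_⟩
  have cont : ∀ u v h, Continuous (φ ∘ e u v h) := fun u v h => φc.comp (hc u v h)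
  constructor
  · intro u v h
    have : IsPathConnected (Set.univ : Set (Set.Icc (0:ℝ) 1)) := by
      have : PathConnectedSpace (Set.Icc (0:ℝ) 1) :=
        isPathConnected_iff_pathConnectedSpace.mp
          ((convex_Icc (0:ℝ) 1).isPathConnected ⟨0, le_rfl, zero_le_one⟩)
      exact isPathConnected_univ
    rw [← Set.image_univ]
    exact this.image (cont u v h)
  · intro u v h
    exact (isCompact_range (cont u v h)).isClosed
  · intro u v h
    exact ⟨_, congrArg φ (hend u v h).1⟩
  · intro u v h
    exact ⟨_, congrArg φ (hend u v h).2⟩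
  · exact φi.comp hinj
  · intro u v h w h1 h2 hw
    obtain ⟨y, hy, he⟩ := mem _ _ _ _ hw
    obtain rfl := φi he
    exact hav u v h w h1 h2 hy
  · intro u v h u' v' h' h1 h2 h3 h4 z hz hz'
    obtain ⟨w, hw, hw', -⟩ := mem2 u v h u' v' h' (by
      intro he
      have : u ∈ ({u', v'} : Set V) := he ▸ Set.mem_insert _ _
      rcases this with h | h
      · exact h1 h
      · exact h2 h) z hz hz'
    rcases hw with rfl | rfl <;> rcases hw' with h | h <;> contradiction
  · intro x a h b h' hab z hz hz'
    obtain ⟨w, hw, hw', rfl⟩ := mem2 x a h x b h' (by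
      intro he
      have : a ∈ ({x, b} : Set V) := he ▸ Set.mem_insert_of_mem _ rfl
      rcases this with h3 | h3
      · exact h.ne h3.symm
      · exact hab h3) z hz hz'
    rcases hw with rfl | rfl
    · rfl
    · rcases hw' with h3 | h3
      · exact absurd h3.symm h.ne
      · exact absurd h3 hab
  · intro x a h r hr hlt
    exact pl_tail _ (cont x a h) _ _ (congrArg φ (hend x a h).1) (congrArg φ (hend x a h).2) r hr hlt

theorem pl_radius (G : SimpleGraph V) [G.LocallyFinite] (f : V → ℂ)
    (R : ∀ u v : V, G.Adj u v → Set ℂ) (P : PlaneData G f R) (x : V) :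
    ∃ r : ℝ, 0 < r ∧ (∀ a, G.Adj x a → r < ‖f a - f x‖) ∧
      ∀ a, G.Adj x a → ∀ p (h : G.Adj p a), p ≠ x → ∀ z ∈ R p a h, r ≤ ‖z - f x‖ := by
  have key : ∀ᶠ r : ℝ in nhdsWithin 0 (Set.Ioi 0), ∀ a ∈ G.neighborFinset x,
      (r < ‖f a - f x‖) ∧ ∀ p ∈ G.neighborFinset a, ∀ (h : G.Adj p a), p ≠ x →
        ∀ z ∈ R p a h, r ≤ ‖z - f x‖ := by
    rw [Filter.eventually_all_finset]
    intro a ha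
    rw [SimpleGraph.mem_neighborFinset] at ha
    refine Filter.Eventually.and ?_ ?_
    · refine nhdsWithin_le_nhds (gt_mem_nhds ?_)
      rw [norm_pos_iff, sub_ne_zero]
      exact fun h => ha.ne (P.inj h).symm
    · rw [Filter.eventually_all_finset]
      intro p hp
      rw [SimpleGraph.mem_neighborFinset] at hp
      by_cases hpx : p = x
      · exact Filter.Eventually.of_forall fun r h hne => absurd hpx hne
      · have hx : f x ∈ (R p a hp.symm)ᶜ := P.avoid p a _ x (Ne.symm hpx) ha.ne
        obtain ⟨ε, hε, hb⟩ := Metric.isOpen_iff.mp (P.closed p a hp.symm).isOpen_compl _ hx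
        have : ∀ᶠ r : ℝ in nhdsWithin 0 (Set.Ioi 0), r < ε :=
          nhdsWithin_le_nhds (gt_mem_nhds hε)
        filter_upwards [this] with r hr h _ z hz
        by_contra hlt
        push Not at hlt
        exact hb (by rw [Metric.mem_ball, dist_eq_norm]; linarith) hz
  have k2 : ∀ᶠ r : ℝ in nhdsWithin 0 (Set.Ioi 0), 0 < r := self_mem_nhdsWithin
  obtain ⟨r, h1, h2⟩ := (key.and k2).exists
  refine ⟨r, h2, fun a ha => (h1 a (by simpa using ha)).1, fun a ha p h hne z hz => ?_⟩
  exact (h1 a (by simpa using ha)).2 p (by simpa using h.symm) h hne z hz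

theorem pl_conn (G : SimpleGraph V) (f : V → ℂ)
    (R : ∀ u v : V, G.Adj u v → Set ℂ) (P : PlaneData G f R) (x : V) (r : ℝ)
    (hr : ∀ a, G.Adj x a → ∀ p (h : G.Adj p a), p ≠ x → ∀ z ∈ R p a h, r ≤ ‖z - f x‖)
    (e : V ⊕ Sym2 V) (a c : V) (hac : a ≠ c) (ha : G.Adj x a) (hc : G.Adj x c)
    (hea : CInc G x e a) (hec : CInc G x e c) :
    ∃ M : Set ℂ, IsPathConnected M ∧ f a ∈ M ∧ f c ∈ M ∧ (∀ z ∈ M, r ≤ ‖z - f x‖) ∧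
      ∀ z ∈ M, ∃ p q h, z ∈ R p q h ∧
        (p ≠ x ∧ (G.Adj x p → p = a ∨ p = c) ∧ (¬ G.Adj x p → e = Sum.inl p)) ∧
        (q ≠ x ∧ (G.Adj x q → q = a ∨ q = c) ∧ (¬ G.Adj x q → e = Sum.inl q)) := by
  have Pa : a ≠ x ∧ (G.Adj x a → a = a ∨ a = c) ∧ (¬ G.Adj x a → e = Sum.inl a) :=
    ⟨ha.ne', fun _ => Or.inl rfl, fun h => absurd ha h⟩
  have Pc : c ≠ x ∧ (G.Adj x c → c = a ∨ c = c) ∧ (¬ G.Adj x c → e = Sum.inl c) :=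
    ⟨hc.ne', fun _ => Or.inr rfl, fun h => absurd hc h⟩
  rcases e with w | s
  · obtain ⟨h1, h2, h3⟩ := hea
    obtain ⟨h4, -, -⟩ := hec
    have Pw : w ≠ x ∧ (G.Adj x w → w = a ∨ w = c) ∧
        (¬ G.Adj x w → (Sum.inl w : V ⊕ Sym2 V) = Sum.inl w) :=
      ⟨h3, fun h => absurd h h2, fun _ => rfl⟩
    refine ⟨R w a h1 ∪ R w c h4, (P.pc _ _ _).union (P.pc _ _ _)
      ⟨f w, P.left _ _ _, P.left _ _ _⟩, Or.inl (P.right _ _ _), Or.inr (P.right _ _ _), ?_, ?_⟩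
    · rintro z (hz | hz)
      · exact hr a ha w h1 h3 z hz
      · exact hr c hc w h4 h3 z hz
    · rintro z (hz | hz)
      · exact ⟨w, a, h1, hz, Pw, Pa⟩
      · exact ⟨w, c, h4, hz, Pw, Pc⟩
  · obtain ⟨h1, h2⟩ := hea
    obtain ⟨h3, -⟩ := hec
    have hs : s = s(a, c) := (Sym2.mem_and_mem_iff hac).mp ⟨h1, h3⟩
    have hadj : G.Adj a c := by rw [hs] at h2; exact h2
    exact ⟨R a c hadj, P.pc _ _ _, P.left _ _ _, P.right _ _ _,
      fun z hz => hr c hc a hadj ha.ne' z hz, fun z hz => ⟨a, c, hadj, hz, Pa, Pc⟩⟩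

/-- Cyclic ordering of the neighbours by angle. -/
theorem pl_order (N : Finset V) (D : ℕ) (hD : N.card = D) (hpos : 0 < D) (θ : V → ℝ)
    (hθ : ∀ a ∈ N, ∀ b ∈ N, θ a = θ b → a = b)
    (h1 : ∀ a, -Real.pi < θ a) (h2 : ∀ a, θ a ≤ Real.pi) :
    ∃ (u : ℤ → V) (Θ : ℤ → ℝ), (∀ i, u (i + D) = u i) ∧
      (∀ i j : ℤ, i ≤ j → j < i + D → u i = u j → i = j) ∧ (∀ i, u i ∈ N) ∧
      (∀ a ∈ N, ∀ k : ℤ, ∃ j : ℤ, k ≤ j ∧ j < k + D ∧ u j = a) ∧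
      (∀ i j : ℤ, i < j → Θ i < Θ j) ∧ (∀ i, Θ (i + D) = Θ i + 2 * Real.pi) ∧
      ∀ i, ∃ n : ℤ, Θ i = θ (u i) + n * (2 * Real.pi) := by
  classical
  have hcard : (N.image θ).card = D := by
    rw [Finset.card_image_of_injOn, hD]
    intro a ha b hb h
    exact hθ a ha b hb h
  set emb := (N.image θ).orderEmbOfFin hcard with hemb
  have hex : ∀ i : Fin D, ∃ a ∈ N, θ a = emb i := by
    intro i
    have := (N.image θ).orderEmbOfFin_mem hcard i
    rw [Finset.mem_image] at this
    exact this
  choose u0 hu0 hθ0 using hex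
  have hDz : (0 : ℤ) < D := by exact_mod_cast hpos
  let idx : ℤ → Fin D := fun j => ⟨(j % D).toNat, by
    have a1 := Int.emod_nonneg j hDz.ne'
    have a2 := Int.emod_lt_of_pos j hDz
    omega⟩
  have idxper : ∀ j, idx (j + D) = idx j := by
    intro j; simp [idx]
  have idxlt : ∀ i j : ℤ, i % D < j % D → idx i < idx j := by
    intro i j h
    have a1 := Int.emod_nonneg i hDz.ne'
    rw [Fin.lt_def]
    simp only [idx]
    omega
  have idxeq : ∀ i j : ℤ, idx i = idx j → i % D = j % D := by
    intro i j h
    have a1 := Int.emod_nonneg i hDz.ne'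
    have a2 := Int.emod_nonneg j hDz.ne'
    have := congrArg Fin.val h
    simp only [idx] at this
    omega
  have u0inj : ∀ i j, u0 i = u0 j → i = j := by
    intro i j h
    apply emb.injective
    rw [← hθ0, ← hθ0, h]
  refine ⟨fun j => u0 (idx j), fun j => emb (idx j) + (j / D : ℤ) * (2 * Real.pi), ?_, ?_, ?_,
    ?_, ?_, ?_, ?_⟩
  · intro i; simp only [idxper]
  · intro i j hij hlt h
    have h3 := idxeq _ _ (u0inj _ _ h)
    have h4 : (j - i) % D = 0 := Int.emod_eq_emod_iff_emod_sub_eq_zero.mp h3.symm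
    rw [Int.emod_eq_of_lt (by omega) (by omega)] at h4
    omega
  · intro i; exact hu0 _
  · intro a ha k
    have : θ a ∈ Set.range emb := by
      rw [hemb, Finset.range_orderEmbOfFin]
      simpa using ⟨a, ha, rfl⟩
    obtain ⟨i, hi⟩ := this
    refine ⟨k + (((i : ℕ) : ℤ) - k) % D, ?_, ?_, ?_⟩
    · have := Int.emod_nonneg (((i : ℕ) : ℤ) - k) hDz.ne'
      omega
    · have := Int.emod_lt_of_pos (((i : ℕ) : ℤ) - k) hDz
      omega
    · apply hθ _ (hu0 _) _ ha
      rw [hθ0, ← hi]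
      congr 1
      ext
      simp only [idx, Int.add_emod_emod, add_sub_cancel]
      rw [Int.emod_eq_of_lt (by omega) (by have := i.2; omega)]
      simp
  · intro i j hij
    have hle : i / D ≤ j / D := Int.ediv_le_ediv hDz hij.le
    rcases hle.eq_or_lt with h | h
    · have a1 := Int.emod_add_mul_ediv i D
      have a2 := Int.emod_add_mul_ediv j D
      rw [h] at a1
      have := emb.strictMono (idxlt i j (by omega))
      simp only [h]
      linarith
    · have b1 : ((i / D : ℤ) : ℝ) + 1 ≤ (j / D : ℤ) := by exact_mod_cast h
      have b2 := h1 (u0 (idx j))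
      have b3 := h2 (u0 (idx i))
      rw [hθ0] at b2 b3
      have := Real.pi_pos
      nlinarith
  · intro i
    simp only [idxper]
    rw [Int.add_ediv_of_dvd_right (dvd_refl _), Int.ediv_self hDz.ne']
    push_cast
    ring
  · intro i
    exact ⟨i / D, by rw [hθ0]⟩

theorem pl_main (G : SimpleGraph V) [G.LocallyFinite] (hp : IsPlanar G) (x : V)
    (hdx : 0 < G.degree x) :
    ∃ u : ℤ → V, (∀ i, u (i + G.degree x) = u i) ∧
      (∀ i j : ℤ, i ≤ j → j < i + G.degree x → u i = u j → i = j) ∧ (∀ i, G.Adj x (u i)) ∧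
      (∀ a, G.Adj x a → ∀ k : ℤ, ∃ j : ℤ, k ≤ j ∧ j < k + G.degree x ∧ u j = a) ∧
      ∀ (e e' : V ⊕ Sym2 V) (i j k l : ℤ), i < j → j < k → k < l → l < i + G.degree x → e ≠ e' →
        CInc G x e (u i) → CInc G x e (u k) → CInc G x e' (u j) → CInc G x e' (u l) → False := by
  obtain ⟨f, R, P⟩ := pl_data G hp
  obtain ⟨r, hr, hr1, hr2⟩ := pl_radius G f R P x
  have ht : ∀ a, ∃ (Tl : Set ℂ) (p : ℂ), ∀ h : G.Adj x a, Tl ⊆ R x a h ∧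
      IsPathConnected Tl ∧ f a ∈ Tl ∧ p ∈ Tl ∧ (∀ z ∈ Tl, r ≤ ‖z - f x‖) ∧ ‖p - f x‖ = r := by
    intro a
    by_cases h : G.Adj x a
    · obtain ⟨Tl, p, hh⟩ := P.tail x a h r hr (hr1 a h)
      exact ⟨Tl, p, fun _ => hh⟩
    · exact ⟨∅, 0, fun h' => absurd h' h⟩
  choose Tl p htl using ht
  have tt : ∀ a b, G.Adj x a → G.Adj x b → a ≠ b → ∀ z, z ∈ Tl a → z ∈ Tl b → False := by
    intro a b ha hb hab z hza hzb
    have h1 := P.meet x a ha b hb hab z ((htl a ha).1 hza) ((htl b hb).1 hzb)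
    have h2 := (htl a ha).2.2.2.2.1 z hza
    rw [h1, sub_self, norm_zero] at h2
    linarith
  let θ : V → ℝ := fun a => Complex.arg (p a - f x)
  have hpθ : ∀ a, G.Adj x a → p a = f x + r * Complex.exp (θ a * Complex.I) := by
    intro a ha
    have := Complex.norm_mul_exp_arg_mul_I (p a - f x)
    rw [(htl a ha).2.2.2.2.2] at this
    simp only [θ]
    rw [this]
    ring
  obtain ⟨u, Θ, h1, h2, h3, h4, h5, h6, h7⟩ := pl_order (G.neighborFinset x) (G.degree x)
    (G.card_neighborFinset_eq_degree x) hdx θ (by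
      intro a ha b hb hab
      rw [SimpleGraph.mem_neighborFinset] at ha hb
      by_contra hne
      apply tt a b ha hb hne (p a) (htl a ha).2.2.2.1
      have : p a = p b := by rw [hpθ a ha, hpθ b hb, hab]
      rw [this]
      exact (htl b hb).2.2.2.1) (fun a => Complex.neg_pi_lt_arg _) (fun a => Complex.arg_le_pi _)
  have hadj : ∀ i, G.Adj x (u i) := fun i => by simpa using h3 i
  have hpΘ : ∀ i, f x + r * Complex.exp (Θ i * Complex.I) ∈ Tl (u i) := by
    intro i
    have : f x + r * Complex.exp (Θ i * Complex.I) = p (u i) := by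
      obtain ⟨n, hn⟩ := h7 i
      rw [hpθ _ (hadj i), hn]
      congr 2
      push_cast
      rw [add_mul, Complex.exp_add]
      have : Complex.exp (n * (2 * Real.pi) * Complex.I) = 1 := by
        rw [Complex.exp_eq_one_iff]
        exact ⟨n, by ring⟩
      rw [this, mul_one]
    rw [this]
    exact (htl _ (hadj i)).2.2.2.1
  refine ⟨u, h1, h2, hadj, fun a ha => h4 a (by simpa using ha), ?_⟩
  intro e e' i j k l hij hjk hkl hli hne c1 c2 c3 c4
  have nij : u i ≠ u j := fun h => by have := h2 i j (by omega) (by omega) h; omega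
  have nik : u i ≠ u k := fun h => by have := h2 i k (by omega) (by omega) h; omega
  have nil : u i ≠ u l := fun h => by have := h2 i l (by omega) (by omega) h; omega
  have njk : u j ≠ u k := fun h => by have := h2 j k (by omega) (by omega) h; omega
  have njl : u j ≠ u l := fun h => by have := h2 j l (by omega) (by omega) h; omega
  have nkl : u k ≠ u l := fun h => by have := h2 k l (by omega) (by omega) h; omega
  obtain ⟨M, m1, m2, m3, m4, m5⟩ := pl_conn G f R P x r hr2 e (u i) (u k) nik (hadj i) (hadj k) c1 c2
  obtain ⟨M', m1', m2', m3', m4', m5'⟩ :=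
    pl_conn G f R P x r hr2 e' (u j) (u l) njl (hadj j) (hadj l) c3 c4
  have tM : ∀ (e : V ⊕ Sym2 V) (a b c : V), G.Adj x a → a ≠ b → a ≠ c → ∀ z, z ∈ Tl a →
      (∃ p q h, z ∈ R p q h ∧
        (p ≠ x ∧ (G.Adj x p → p = b ∨ p = c) ∧ (¬ G.Adj x p → e = Sum.inl p)) ∧
        (q ≠ x ∧ (G.Adj x q → q = b ∨ q = c) ∧ (¬ G.Adj x q → e = Sum.inl q))) → False := by
    intro e a b c ha hab hac z hz ⟨p, q, h, hz', hp, hq⟩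
    refine P.disj x a ha p q h hp.1.symm hq.1.symm ?_ ?_ z ((htl a ha).1 hz) hz'
    · rintro rfl
      rcases hp.2.1 ha with h | h
      · exact hab h
      · exact hac h
    · rintro rfl
      rcases hq.2.1 ha with h | h
      · exact hab h
      · exact hac h
  have pc : ∀ (M : Set ℂ) (a c : V), IsPathConnected M → f a ∈ M → f c ∈ M → G.Adj x a →
      G.Adj x c → IsPathConnected (Tl a ∪ M ∪ Tl c) := by
    intro M a c hM ha hc hxa hxc
    exact (((htl a hxa).2.1).union hM ⟨f a, (htl a hxa).2.2.1, ha⟩).union (htl c hxc).2.1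
      ⟨f c, Or.inr hc, (htl c hxc).2.2.1⟩
  have nm : ∀ (M : Set ℂ) (a c : V), (∀ z ∈ M, r ≤ ‖z - f x‖) → G.Adj x a →
      G.Adj x c → ∀ z ∈ Tl a ∪ M ∪ Tl c, r ≤ ‖z - f x‖ := by
    rintro M a c hM hxa hxc z ((hz | hz) | hz)
    · exact (htl a hxa).2.2.2.2.1 z hz
    · exact hM z hz
    · exact (htl c hxc).2.2.2.2.1 z hz
  have same : ∀ q, (q ≠ x ∧ (G.Adj x q → q = u i ∨ q = u k) ∧ (¬ G.Adj x q → e = Sum.inl q)) →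
      (q ≠ x ∧ (G.Adj x q → q = u j ∨ q = u l) ∧ (¬ G.Adj x q → e' = Sum.inl q)) → False := by
    rintro q ⟨-, a1, a2⟩ ⟨-, b1, b2⟩
    by_cases hq : G.Adj x q
    · rcases a1 hq with h | h <;> rcases b1 hq with h' | h' <;> rw [h] at h'
      · exact nij h'
      · exact nil h'
      · exact njk h'.symm
      · exact nkl h'
    · exact hne ((a2 hq).trans (b2 hq).symm)
  refine cr_outside (Tl (u i) ∪ M ∪ Tl (u k)) (Tl (u j) ∪ M' ∪ Tl (u l))
    (pc _ _ _ m1 m2 m3 (hadj i) (hadj k)) (pc _ _ _ m1' m2' m3' (hadj j) (hadj l)) ?_ (f x) r hr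
    (nm _ _ _ m4 (hadj i) (hadj k)) (nm _ _ _ m4' (hadj j) (hadj l)) (Θ i) (Θ j) (Θ k) (Θ l)
    (h5 _ _ hij) (h5 _ _ hjk) (h5 _ _ hkl) (by rw [← h6]; exact h5 _ _ hli)
    (Or.inl (Or.inl (hpΘ i))) (Or.inr (hpΘ k)) (Or.inl (Or.inl (hpΘ j))) (Or.inr (hpΘ l))
  rw [Set.disjoint_left]
  rintro z ((hz | hz) | hz) ((hz' | hz') | hz')
  · exact tt _ _ (hadj i) (hadj j) nij z hz hz'
  · exact tM e' _ _ _ (hadj i) nij nil z hz (m5' z hz')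
  · exact tt _ _ (hadj i) (hadj l) nil z hz hz'
  · exact tM e _ _ _ (hadj j) nij.symm njk z hz' (m5 z hz)
  · obtain ⟨p, q, h, hz1, hp, hq⟩ := m5 z hz
    obtain ⟨p', q', h', hz1', hp', hq'⟩ := m5' z hz'
    refine P.disj p q h p' q' h' ?_ ?_ ?_ ?_ z hz1 hz1'
    · rintro rfl; exact same _ hp hp'
    · rintro rfl; exact same _ hp hq'
    · rintro rfl; exact same _ hq hp'
    · rintro rfl; exact same _ hq hq'
  · exact tM e _ _ _ (hadj l) nil.symm nkl.symm z hz' (m5 z hz)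
  · exact tt _ _ (hadj k) (hadj j) njk.symm z hz hz'
  · exact tM e' _ _ _ (hadj k) njk.symm nkl z hz (m5' z hz')
  · exact tt _ _ (hadj k) (hadj l) nkl z hz hz'

end Plane

theorem pl_false (G : SimpleGraph V) [G.LocallyFinite]
    (hconn : G.Connected) (hplanar : IsPlanar G)
    (hmin : ∀ u : V, 3 ≤ G.degree u) (hpos : PositivelyCurved G)
    (x : V) (hdx : 18 ≤ G.degree x) : False := by
  obtain ⟨u, h1, h2, h3, h4, h5⟩ := pl_main G hplanar x (by omega)
  exact Core.contradiction (G := G) (x := x) (D := G.degree x) (u := u)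
    { hD := by exact_mod_cast hdx
      per := h1
      inj := h2
      adj := h3
      surj := h4
      nc := h5
      deg := fun y => hmin _
      star := fun y e S T hS hT => cv_star2 G hconn hpos x (u y) e (h3 y) hdx u S T hS hT
      star0 := fun y S T hS hT => cv_star1 G hconn hpos x (u y) (h3 y) hdx u S T hS hT }

/-- Claim 2: in a simple connected positively curved planar graph with minimum degree
at least 3, drawn in the plane, if `x` is a max-degree vertex with `deg x ≥ 18` and
`v` enumerates the neighbors of `x` in clockwise order, then an `ℓ`-cap with
`4 ≤ ℓ ≤ 8` contains no internal `(j-i)`-cap with `i, j ∈ [k+1, k+ℓ-1]` and `j-i ≥ 2`. -/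
theorem no_internal_cap (G : SimpleGraph V) [G.LocallyFinite]
    (hconn : G.Connected) (hplanar : IsPlanar G)
    (hmin : ∀ u : V, 3 ≤ G.degree u) (hpos : PositivelyCurved G)
    (x : V) (hmax : ∀ u : V, G.degree u ≤ G.degree x) (hdx : 18 ≤ G.degree x)
    (t : ℕ) (ht : t = G.degree x) (v : ℕ → V)
    (hper : ∀ i : ℕ, v (i + t) = v i)
    (hvinj : ∀ i < t, ∀ j < t, v i = v j → i = j)
    (hvmem : ∀ i : ℕ, G.Adj x (v i))
    (hvsurj : ∀ u : V, G.Adj x u → ∃ i < t, v i = u)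
    (k ℓ : ℕ) (hℓ₁ : 4 ≤ ℓ) (hℓ₂ : ℓ ≤ 8) (hcap : IsCap G x v k ℓ) :
    ¬ ∃ i j : ℕ, k + 1 ≤ i ∧ j ≤ k + ℓ - 1 ∧ i + 2 ≤ j ∧ IsCap G x v i (j - i) := by
  exact fun _ => pl_false G hconn hplanar hmin hpos x hdx
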